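/- Let (E, {f_i}_{i=1}^m) ∈ 𝓔 with convex hull I = [a,b]. Then the following statements are equivalent: (i) f_1(I) ∩ f_2(I) ≠ ∅ or f_{m−1}(I) ∩ f_m(I) ≠ ∅; (ii) dim_H U_k(E) = dim_H U_1(E) for every integer k ≥ 1; (iii) f_1(b) ∈ U_{ℵ₀}(E) or f_m(a) ∈ U_{ℵ₀}(E); (iv) U_{ℵ₀}(E) is countably infinite. -/

import Mathlib

open Set Filter MeasureTheory

/-- A self-similar iterated function system on `ℝ` given by `m` similitudes
`f i x = r i * x + t i` (for `1 ≤ i ≤ m`, `m ≥ 3`), together with its attractor `E`: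
the unique nonempty compact set with `E = ⋃_{i=1}^m f_i(E)`. -/
structure ClassE where
  m : ℕ
  r : ℕ → ℝ
  t : ℕ → ℝ
  E : Set ℝ
  hm : 3 ≤ m
  hr : ∀ i, 1 ≤ i → i ≤ m → 0 < r i ∧ r i < 1
  hEne : E.Nonempty
  hEcpt : IsCompact E
  hEinv : E = ⋃ i ∈ Finset.Icc 1 m, (fun x => r i * x + t i) '' E

namespace ClassE

/-- The `i`-th similitude. -/
def f (S : ClassE) (i : ℕ) (x : ℝ) : ℝ := S.r i * x + S.t i

/-- Left endpoint `a` of the convex hull of `E`. -/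
noncomputable def a (S : ClassE) : ℝ := sInf S.E

/-- Right endpoint `b` of the convex hull of `E`. -/
noncomputable def b (S : ClassE) : ℝ := sSup S.E

/-- The convex hull `I = [a, b]` of `E`. -/
noncomputable def I (S : ClassE) : Set ℝ := Set.Icc S.a S.b

/-- Condition (A): `a = f_1(a) < f_2(a) < ⋯ < f_m(a) < f_m(b) = b`. -/
def condA (S : ClassE) : Prop :=
  S.f 1 S.a = S.a ∧ (∀ i, 1 ≤ i → i < S.m → S.f i S.a < S.f (i + 1) S.a) ∧
    S.f S.m S.a < S.f S.m S.b ∧ S.f S.m S.b = S.b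

/-- Condition (B): `f_i(I) ∩ f_{i+2}(I) = ∅` for all `1 ≤ i ≤ m - 2`. -/
def condB (S : ClassE) : Prop :=
  ∀ i, 1 ≤ i → i + 2 ≤ S.m → S.f i '' S.I ∩ S.f (i + 2) '' S.I = ∅

/-- Condition (C): there are `i, j ∈ {1, …, m-1}` with `f_i(I) ∩ f_{i+1}(I) = ∅` and
`f_j(I) ∩ f_{j+1}(I) ≠ ∅`. -/
def condC (S : ClassE) : Prop :=
  (∃ i, 1 ≤ i ∧ i + 1 ≤ S.m ∧ S.f i '' S.I ∩ S.f (i + 1) '' S.I = ∅) ∧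
    (∃ j, 1 ≤ j ∧ j + 1 ≤ S.m ∧ S.f j '' S.I ∩ S.f (j + 1) '' S.I ≠ ∅)

/-- Condition (D): whenever `f_i(I) ∩ f_{i+1}(I) ≠ ∅` there are `u, v ≥ 1` with
`f_i(I) ∩ f_{i+1}(I) = f_i ∘ f_m^u (I) = f_{i+1} ∘ f_1^v (I)`. -/
def condD (S : ClassE) : Prop :=
  ∀ i, 1 ≤ i → i + 1 ≤ S.m → S.f i '' S.I ∩ S.f (i + 1) '' S.I ≠ ∅ →
    ∃ u v : ℕ, 1 ≤ u ∧ 1 ≤ v ∧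
      S.f i '' S.I ∩ S.f (i + 1) '' S.I = (S.f i ∘ (S.f S.m)^[u]) '' S.I ∧
      S.f i '' S.I ∩ S.f (i + 1) '' S.I = (S.f (i + 1) ∘ (S.f 1)^[v]) '' S.I

/-- Membership in the class `𝓔`: conditions (A)–(D). -/
def goodE (S : ClassE) : Prop := S.condA ∧ S.condB ∧ S.condC ∧ S.condD

/-- `prefixMap d n = f_{d 0} ∘ f_{d 1} ∘ ⋯ ∘ f_{d (n-1)}`. -/
def prefixMap (S : ClassE) (d : ℕ → ℕ) : ℕ → ℝ → ℝ
  | 0 => id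
  | n + 1 => S.prefixMap d n ∘ S.f (d n)

/-- `d : ℕ → ℕ` (with digits in `{1, …, m}`) is a coding of `x` if
`x = lim_n f_{d 0} ∘ ⋯ ∘ f_{d (n-1)} (0)`. -/
def isCoding (S : ClassE) (d : ℕ → ℕ) (x : ℝ) : Prop :=
  (∀ n, 1 ≤ d n ∧ d n ≤ S.m) ∧
    Tendsto (fun n => S.prefixMap d n 0) atTop (nhds x)

/-- The set of codings of `x`. -/
def codings (S : ClassE) (x : ℝ) : Set (ℕ → ℕ) := {d | S.isCoding d x}

/-- `U k E`: the set of points of `E` having exactly `k` distinct codings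
(`k` a cardinal; e.g. `k = ℵ₀` for countably infinitely many codings,
`k = 𝔠 = 2^ℵ₀` for a continuum of codings). -/
def U (S : ClassE) (k : Cardinal) : Set ℝ :=
  {x ∈ S.E | Cardinal.mk (S.codings x) = k}

/-! ### Basic facts -/

/-- valid digits -/
def V (S : ClassE) (i : ℕ) : Prop := 1 ≤ i ∧ i ≤ S.m

/-- prepend a digit -/
def cons (i : ℕ) (d : ℕ → ℕ) : ℕ → ℕ
  | 0 => i
  | n + 1 => d n

/-- drop the first digit -/
def tl (d : ℕ → ℕ) : ℕ → ℕ := fun n => d (n + 1)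

@[simp] lemma cons_zero (i : ℕ) (d : ℕ → ℕ) : cons i d 0 = i := rfl
@[simp] lemma cons_succ (i : ℕ) (d : ℕ → ℕ) (n : ℕ) : cons i d (n + 1) = d n := rfl
@[simp] lemma tl_cons (i : ℕ) (d : ℕ → ℕ) : tl (cons i d) = d := rfl
lemma cons_tl (d : ℕ → ℕ) : cons (d 0) (tl d) = d := by
  funext n; cases n <;> rfl
lemma cons_inj (i : ℕ) : Function.Injective (cons i) := fun d e h => by
  have := congrArg tl h; simpa using this

/-- inverse branch -/
noncomputable def g (S : ClassE) (i : ℕ) (x : ℝ) : ℝ := (x - S.t i) / S.r i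

lemma V_one (S : ClassE) : S.V 1 := ⟨le_rfl, by have := S.hm; omega⟩
lemma V_m (S : ClassE) : S.V S.m := ⟨by have := S.hm; omega, le_rfl⟩
lemma r_pos (S : ClassE) {i : ℕ} (hi : S.V i) : 0 < S.r i := (S.hr i hi.1 hi.2).1
lemma r_lt (S : ClassE) {i : ℕ} (hi : S.V i) : S.r i < 1 := (S.hr i hi.1 hi.2).2

lemma g_f (S : ClassE) {i : ℕ} (hi : S.V i) (x : ℝ) : S.g i (S.f i x) = x := by
  have := (S.r_pos hi).ne'
  unfold g f; field_simp; ring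
lemma f_g (S : ClassE) {i : ℕ} (hi : S.V i) (x : ℝ) : S.f i (S.g i x) = x := by
  have := (S.r_pos hi).ne'
  unfold g f; field_simp; ring
lemma f_inj (S : ClassE) {i : ℕ} (hi : S.V i) : Function.Injective (S.f i) :=
  Function.LeftInverse.injective (g := S.g i) (S.g_f hi)
lemma f_mono (S : ClassE) {i : ℕ} (hi : S.V i) : StrictMono (S.f i) := fun x y h => by
  have := S.r_pos hi
  unfold f; nlinarith
lemma f_cont (S : ClassE) (i : ℕ) : Continuous (S.f i) := by
  unfold f; fun_prop
lemma g_cont (S : ClassE) (i : ℕ) : Continuous (S.g i) := by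
  unfold g; fun_prop

lemma exists_rho (S : ClassE) : ∃ ρ : ℝ, 0 ≤ ρ ∧ ρ < 1 ∧ ∀ i, S.V i → S.r i ≤ ρ := by
  obtain ⟨j, hj, h⟩ := Finset.exists_max_image (Finset.Icc 1 S.m) S.r
    ⟨1, by simpa using S.V_one.2⟩
  have hj' : S.V j := by simpa [V] using hj
  exact ⟨S.r j, (S.r_pos hj').le, S.r_lt hj', fun i hi => h i (by simpa [V] using hi)⟩

lemma prefix_succ (S : ClassE) (d : ℕ → ℕ) (n : ℕ) (x : ℝ) :
    S.prefixMap d (n + 1) x = S.f (d 0) (S.prefixMap (tl d) n x) := by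
  induction n generalizing x with
  | zero => simp [prefixMap]
  | succ n ih =>
    rw [prefixMap, Function.comp_apply, ih]
    simp [prefixMap, tl]

lemma prefix_dist (S : ClassE) {ρ : ℝ} (h0 : 0 ≤ ρ) (hρ : ∀ i, S.V i → S.r i ≤ ρ)
    (d : ℕ → ℕ) (hd : ∀ n, S.V (d n)) (n : ℕ) (x y : ℝ) :
    |S.prefixMap d n x - S.prefixMap d n y| ≤ ρ ^ n * |x - y| := by
  induction n generalizing x y with
  | zero => simp [prefixMap]
  | succ n ih =>
    simp only [prefixMap, Function.comp_apply]
    refine (ih _ _).trans ?_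
    have : S.f (d n) x - S.f (d n) y = S.r (d n) * (x - y) := by unfold f; ring
    rw [this, abs_mul, abs_of_pos (S.r_pos (hd n)), pow_succ, mul_assoc]
    have := hρ _ (hd n)
    gcongr

/-- If all points `y n` remain bounded then prefix maps converge -/
lemma coding_of_seq (S : ClassE) (d : ℕ → ℕ) (hd : ∀ n, S.V (d n)) (x M : ℝ) (y : ℕ → ℝ)
    (hy : ∀ n, |y n| ≤ M) (hx : ∀ n, S.prefixMap d n (y n) = x) : d ∈ S.codings x := by
  obtain ⟨ρ, h0, h1, hρ⟩ := S.exists_rho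
  refine ⟨hd, ?_⟩
  rw [tendsto_iff_dist_tendsto_zero]
  have hl : Tendsto (fun n : ℕ => ρ ^ n * M) atTop (nhds 0) := by
    simpa using (tendsto_pow_atTop_nhds_zero_of_lt_one h0 h1).mul_const M
  refine squeeze_zero (fun _ => dist_nonneg) (fun n => ?_) hl
  rw [Real.dist_eq, ← hx n]
  refine (S.prefix_dist h0 hρ d hd n 0 (y n)).trans ?_
  have := hy n
  simp only [zero_sub, abs_neg]
  gcongr

lemma coding_cons (S : ClassE) {i : ℕ} (hi : S.V i) {d : ℕ → ℕ} {x : ℝ} :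
    cons i d ∈ S.codings (S.f i x) ↔ d ∈ S.codings x := by
  have key : (fun n => S.prefixMap (cons i d) (n + 1) 0) = fun n => S.f i (S.prefixMap d n 0) := by
    funext n; rw [prefix_succ]; simp
  constructor
  · rintro ⟨h1, h2⟩
    refine ⟨fun n => by simpa using h1 (n + 1), ?_⟩
    have h3 := (tendsto_add_atTop_iff_nat 1).2 h2
    rw [key] at h3
    have h4 := ((S.g_cont i).tendsto _).comp h3
    simpa [Function.comp_def, S.g_f hi] using h4
  · rintro ⟨h1, h2⟩
    refine ⟨fun n => ?_, ?_⟩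
    · cases n with
      | zero => exact hi
      | succ n => simpa using h1 n
    · rw [← tendsto_add_atTop_iff_nat 1, key]
      exact ((S.f_cont i).tendsto _).comp h2

lemma coding_step (S : ClassE) {d : ℕ → ℕ} {x : ℝ} (h : d ∈ S.codings x) :
    S.V (d 0) ∧ tl d ∈ S.codings (S.g (d 0) x) := by
  have h0 : S.V (d 0) := h.1 0
  refine ⟨h0, ?_⟩
  rw [← S.coding_cons h0, cons_tl, S.f_g h0]
  exact h

lemma coding_unique (S : ClassE) {d : ℕ → ℕ} {x y : ℝ} (h : d ∈ S.codings x)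
    (h' : d ∈ S.codings y) : x = y := tendsto_nhds_unique h.2 h'.2

lemma f_mem_E (S : ClassE) {i : ℕ} (hi : S.V i) {x : ℝ} (hx : x ∈ S.E) : S.f i x ∈ S.E := by
  rw [S.hEinv]
  simp only [mem_iUnion]
  exact ⟨i, by simpa [V] using hi, x, hx, rfl⟩

lemma E_cases (S : ClassE) {x : ℝ} (hx : x ∈ S.E) : ∃ i, S.V i ∧ S.g i x ∈ S.E := by
  rw [S.hEinv] at hx
  simp only [mem_iUnion] at hx
  obtain ⟨i, hi, y, hy, rfl⟩ := hx
  have hi' : S.V i := by simpa [V] using hi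
  refine ⟨i, hi', ?_⟩
  have := S.g_f hi' y
  unfold f at this
  rwa [this]

lemma a_mem (S : ClassE) : S.a ∈ S.E := S.hEcpt.sInf_mem S.hEne
lemma b_mem (S : ClassE) : S.b ∈ S.E := S.hEcpt.sSup_mem S.hEne
lemma E_sub (S : ClassE) {x : ℝ} (hx : x ∈ S.E) : x ∈ S.I :=
  ⟨csInf_le S.hEcpt.bddBelow hx, le_csSup S.hEcpt.bddAbove hx⟩
lemma a_I (S : ClassE) : S.a ∈ S.I := S.E_sub S.a_mem
lemma b_I (S : ClassE) : S.b ∈ S.I := S.E_sub S.b_mem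
lemma f_I (S : ClassE) {i : ℕ} (hi : S.V i) {x : ℝ} (hx : x ∈ S.I) : S.f i x ∈ S.I :=
  ⟨(S.E_sub (S.f_mem_E hi S.a_mem)).1.trans ((S.f_mono hi).monotone hx.1),
    ((S.f_mono hi).monotone hx.2).trans (S.E_sub (S.f_mem_E hi S.b_mem)).2⟩
lemma fit_I (S : ClassE) {i : ℕ} (hi : S.V i) (n : ℕ) {x : ℝ} (hx : x ∈ S.I) :
    (S.f i)^[n] x ∈ S.I := by
  induction n with
  | zero => exact hx
  | succ n ih => rw [Function.iterate_succ_apply']; exact S.f_I hi ih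

lemma prefix_E (S : ClassE) (d : ℕ → ℕ) (hd : ∀ n, S.V (d n)) (n : ℕ) {x : ℝ} (hx : x ∈ S.E) :
    S.prefixMap d n x ∈ S.E := by
  induction n generalizing x with
  | zero => exact hx
  | succ n ih => exact ih (S.f_mem_E (hd n) hx)

lemma mem_E_of_coding (S : ClassE) {d : ℕ → ℕ} {x : ℝ} (h : d ∈ S.codings x) : x ∈ S.E := by
  obtain ⟨ρ, h0, h1, hρ⟩ := S.exists_rho
  have hl : Tendsto (fun n : ℕ => S.prefixMap d n S.a - S.prefixMap d n 0) atTop (nhds 0) := by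
    have hl : Tendsto (fun n : ℕ => ρ ^ n * |S.a - 0|) atTop (nhds 0) := by
      simpa using (tendsto_pow_atTop_nhds_zero_of_lt_one h0 h1).mul_const |S.a - 0|
    exact squeeze_zero_norm (fun n => S.prefix_dist h0 hρ d h.1 n S.a 0) hl
  have h3 : Tendsto (fun n : ℕ => S.prefixMap d n S.a) atTop (nhds x) := by
    simpa using hl.add h.2
  exact S.hEcpt.isClosed.mem_of_tendsto h3
    (Eventually.of_forall fun n => S.prefix_E d h.1 n S.a_mem)

lemma mem_I_of_coding (S : ClassE) {d : ℕ → ℕ} {x : ℝ} (h : d ∈ S.codings x) : x ∈ S.I :=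
  S.E_sub (S.mem_E_of_coding h)

/-- The orbit of `z` along `d`. -/
noncomputable def pt (S : ClassE) (z : ℝ) (d : ℕ → ℕ) : ℕ → ℝ
  | 0 => z
  | n + 1 => S.g (d n) (S.pt z d n)

lemma pt_cons (S : ClassE) (z : ℝ) (i : ℕ) (d : ℕ → ℕ) (n : ℕ) :
    S.pt z (cons i d) (n + 1) = S.pt (S.g i z) d n := by
  induction n with
  | zero => rfl
  | succ n ih => rw [pt, ih, pt, cons_succ]

lemma pt_congr (S : ClassE) (z : ℝ) {d e : ℕ → ℕ} {n : ℕ} (h : ∀ k < n, d k = e k) :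
    S.pt z d n = S.pt z e n := by
  induction n with
  | zero => rfl
  | succ n ih => rw [pt, pt, ih (fun k hk => h k (by omega)), h n (by omega)]

lemma prefix_pt (S : ClassE) (z : ℝ) {d : ℕ → ℕ} (hd : ∀ n, S.V (d n)) (n : ℕ) :
    S.prefixMap d n (S.pt z d n) = z := by
  induction n with
  | zero => rfl
  | succ n ih => rw [prefixMap, pt, Function.comp_apply, S.f_g (hd n), ih]

/-- Rays along which `P` holds. -/
def Ray (S : ClassE) (P : ℝ → Prop) (z : ℝ) : Set (ℕ → ℕ) :=
  {d | (∀ n, S.V (d n)) ∧ ∀ n, P (S.pt z d n)}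

lemma ray_cons (S : ClassE) {P : ℝ → Prop} {z : ℝ} {i : ℕ} (hi : S.V i) (hz : P z)
    {d : ℕ → ℕ} (hd : d ∈ S.Ray P (S.g i z)) : cons i d ∈ S.Ray P z := by
  refine ⟨fun n => ?_, fun n => ?_⟩
  · cases n with
    | zero => exact hi
    | succ n => exact hd.1 n
  · cases n with
    | zero => exact hz
    | succ n => rw [pt_cons]; exact hd.2 n

lemma ray_exists (S : ClassE) {P : ℝ → Prop} (h : ∀ y, P y → ∃ i, S.V i ∧ P (S.g i y))
    {z : ℝ} (hz : P z) : (S.Ray P z).Nonempty := by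
  choose! c hc using h
  let y : ℕ → ℝ := fun n => (fun x => S.g (c x) x)^[n] z
  have hy : ∀ n, P (y n) := by
    intro n
    induction n with
    | zero => exact hz
    | succ n ih =>
      simp only [y, Function.iterate_succ_apply'] at ih ⊢
      exact (hc _ ih).2
  have hp : ∀ n, S.pt z (fun n => c (y n)) n = y n := by
    intro n
    induction n with
    | zero => rfl
    | succ n ih => rw [pt, ih]; simp only [y, Function.iterate_succ_apply']
  exact ⟨fun n => c (y n), fun n => (hc _ (hy n)).1, fun n => by rw [hp]; exact hy n⟩

lemma ray_sub (S : ClassE) {P : ℝ → Prop} (h : ∀ y, P y → y ∈ S.I) {z : ℝ} :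
    S.Ray P z ⊆ S.codings z := by
  rintro d ⟨h1, h2⟩
  refine S.coding_of_seq d h1 z (max |S.a| |S.b|) (S.pt z d) (fun n => ?_)
    (fun n => S.prefix_pt z h1 n)
  exact abs_le_max_abs_abs (h _ (h2 n)).1 (h _ (h2 n)).2

lemma coding_exists (S : ClassE) {x : ℝ} (hx : x ∈ S.E) : (S.codings x).Nonempty :=
  (S.ray_exists (P := fun x => x ∈ S.E) (fun _ hy => S.E_cases hy) hx).mono
    (S.ray_sub fun _ h => S.E_sub h)

/-- apply a word -/
def F (S : ClassE) (w : List ℕ) (x : ℝ) : ℝ := w.foldr S.f x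

lemma F_coding (S : ClassE) (w : List ℕ) (hw : ∀ i ∈ w, S.V i) {x : ℝ} {d : ℕ → ℕ}
    (hd : d ∈ S.codings x) : w.foldr cons d ∈ S.codings (S.F w x) := by
  induction w with
  | nil => exact hd
  | cons i w ih =>
    exact (S.coding_cons (hw i (by simp))).2 (ih fun j hj => hw j (by simp [hj]))

lemma foldr_inj (w : List ℕ) : Function.Injective (fun d => w.foldr cons d) := by
  induction w with
  | nil => exact fun _ _ h => h
  | cons i w ih => exact fun d e h => ih (cons_inj i h)

lemma foldr_apply_lt (w : List ℕ) (d e : ℕ → ℕ) {k : ℕ} (hk : k < w.length) :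
    w.foldr cons d k = w.foldr cons e k := by
  induction w generalizing k with
  | nil => simp at hk
  | cons i w ih =>
    cases k with
    | zero => rfl
    | succ k => exact ih (by simpa using hk)

/-- decompose a coding at position `n` -/
lemma coding_split (S : ClassE) {d : ℕ → ℕ} {x : ℝ} (h : d ∈ S.codings x) (n : ℕ) :
    ∃ w : List ℕ, w.length = n ∧ (∀ i ∈ w, S.V i) ∧ ∃ y, x = S.F w y ∧
      (fun k => d (n + k)) ∈ S.codings y ∧ d = w.foldr cons (fun k => d (n + k)) := by
  induction n generalizing d x with
  | zero => exact ⟨[], rfl, by simp, x, rfl, by simpa using h, by simp⟩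
  | succ n ih =>
    obtain ⟨h0, h1⟩ := S.coding_step h
    obtain ⟨w, hl, hw, y, hy, hc, hd⟩ := ih h1
    have e : (fun k => tl d (n + k)) = fun k => d (n + 1 + k) := by
      funext k; simp [tl]; congr 1; omega
    rw [e] at hc hd
    refine ⟨d 0 :: w, by simp [hl], ?_, y, ?_, hc, ?_⟩
    · intro i hi
      rcases List.mem_cons.1 hi with rfl | hi
      · exact h0
      · exact hw i hi
    · change x = S.f (d 0) (S.F w y)
      rw [← hy, S.f_g h0]
    · change d = cons (d 0) (w.foldr cons _)
      rw [← hd, cons_tl]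

/-! ### The derived symmetric hypotheses -/

/-- overlap between `f_i(I)` and `f_{i+1}(I)` -/
def ov (S : ClassE) (i : ℕ) : Prop := ∃ x ∈ S.I, ∃ y ∈ S.I, S.f i x = S.f (i + 1) y

/-- reflection-symmetric consequences of the hypotheses -/
structure Good (S : ClassE) : Prop where
  ab : S.a < S.b
  fa : S.f 1 S.a = S.a
  fb : S.f S.m S.b = S.b
  far : ∀ i j, 1 ≤ i → i + 2 ≤ j → j ≤ S.m → ∀ x ∈ S.I, ∀ y ∈ S.I, S.f i x ≠ S.f j y
  near : ∀ i, 1 ≤ i → i + 1 ≤ S.m → S.ov i → ∃ u v : ℕ,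
    (∀ x, S.f i ((S.f S.m)^[u + 1] x) = S.f (i + 1) ((S.f 1)^[v + 1] x)) ∧
    ∀ x ∈ S.I, ∀ y ∈ S.I, S.f i x = S.f (i + 1) y → ∃ z ∈ S.I,
      x = (S.f S.m)^[u + 1] z ∧ y = (S.f 1)^[v + 1] z
  gap : ∃ i, 1 ≤ i ∧ i + 1 ≤ S.m ∧ ¬ S.ov i

lemma ov_iff (S : ClassE) (i : ℕ) : S.ov i ↔ S.f i '' S.I ∩ S.f (i + 1) '' S.I ≠ ∅ := by
  rw [← nonempty_iff_ne_empty]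
  constructor
  · rintro ⟨x, hx, y, hy, h⟩
    exact ⟨_, ⟨x, hx, rfl⟩, ⟨y, hy, h.symm⟩⟩
  · rintro ⟨_, ⟨x, hx, rfl⟩, ⟨y, hy, h⟩⟩
    exact ⟨x, hx, y, hy, h.symm⟩

lemma f_image (S : ClassE) {i : ℕ} (hi : S.V i) : S.f i '' S.I = Icc (S.f i S.a) (S.f i S.b) := by
  ext x
  constructor
  · rintro ⟨y, hy, rfl⟩
    exact ⟨(S.f_mono hi).monotone hy.1, (S.f_mono hi).monotone hy.2⟩
  · rintro ⟨h1, h2⟩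
    refine ⟨S.g i x, ⟨?_, ?_⟩, S.f_g hi x⟩
    · rw [← (S.f_mono hi).le_iff_le, S.f_g hi]; exact h1
    · rw [← (S.f_mono hi).le_iff_le, S.f_g hi]; exact h2

lemma it_aff (S : ClassE) (i n : ℕ) : ∃ c : ℝ, ∀ x, (S.f i)^[n] x = S.r i ^ n * x + c := by
  induction n with
  | zero => exact ⟨0, by simp⟩
  | succ n ih =>
    obtain ⟨c, hc⟩ := ih
    refine ⟨S.r i * c + S.t i, fun x => ?_⟩
    rw [Function.iterate_succ_apply', hc]; unfold f; ring

lemma word_aff (S : ClassE) {i j : ℕ} (hi : S.V i) (hj : S.V j) (n : ℕ) :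
    ∃ p c : ℝ, 0 < p ∧ ∀ x, S.f i ((S.f j)^[n] x) = p * x + c := by
  obtain ⟨c, hc⟩ := S.it_aff j n
  refine ⟨S.r i * S.r j ^ n, S.r i * c + S.t i, mul_pos (S.r_pos hi) (pow_pos (S.r_pos hj) n),
    fun x => ?_⟩
  rw [hc]; unfold f; ring

lemma aff_image {p c a b : ℝ} (hp : 0 < p) :
    (fun x => p * x + c) '' Icc a b = Icc (p * a + c) (p * b + c) := by
  ext x
  constructor
  · rintro ⟨y, hy, rfl⟩
    have := hy.1; have := hy.2
    constructor <;> simp only <;> nlinarith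
  · rintro ⟨h1, h2⟩
    refine ⟨(x - c) / p, ⟨?_, ?_⟩, by field_simp; ring⟩
    · rw [le_div_iff₀ hp]; linarith
    · rw [div_le_iff₀ hp]; linarith

lemma fit_inj (S : ClassE) {i : ℕ} (hi : S.V i) (n : ℕ) : Function.Injective (S.f i)^[n] :=
  (S.f_inj hi).iterate n

lemma good_of_goodE (S : ClassE) (h : S.goodE) : S.Good := by
  obtain ⟨⟨A1, A2, A3, A4⟩, B, ⟨⟨i0, hi0, hi1, hi2⟩, -⟩, D⟩ := h
  have hab : S.a < S.b := (S.f_mono S.V_m).lt_iff_lt.1 A3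
  have mono : ∀ i j, 1 ≤ i → i ≤ j → j ≤ S.m → S.f i S.a ≤ S.f j S.a := by
    intro i j hi hij hj
    induction j, hij using Nat.le_induction with
    | base => exact le_rfl
    | succ j hij ih => exact (ih (by omega)).trans (A2 j (by omega) (by omega)).le
  have far : ∀ i, 1 ≤ i → i + 2 ≤ S.m → S.f i S.b < S.f (i + 2) S.a := by
    intro i hi him
    by_contra hc
    push Not at hc
    have : S.f (i + 2) S.a ∈ S.f i '' S.I ∩ S.f (i + 2) '' S.I := by
      refine ⟨?_, ⟨_, S.a_I, rfl⟩⟩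
      rw [S.f_image ⟨hi, by omega⟩]
      exact ⟨mono _ _ hi (by omega) him, hc⟩
    rw [B i hi him] at this
    exact this
  refine ⟨hab, A1, A4, ?_, ?_, ⟨i0, hi0, hi1, ?_⟩⟩
  · intro i j hi hij hj x hx y hy
    have h1 := far i hi (by omega)
    have h2 := mono (i + 2) j (by omega) hij hj
    have h3 := (S.f_mono (i := i) ⟨hi, by omega⟩).monotone hx.2
    have h4 := (S.f_mono (i := j) ⟨by omega, hj⟩).monotone hy.1
    linarith
  · intro i hi him hov
    rw [ov_iff] at hov
    obtain ⟨u, v, hu, hv, e1, e2⟩ := D i hi him hov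
    obtain ⟨u, rfl⟩ : ∃ u', u = u' + 1 := ⟨u - 1, by omega⟩
    obtain ⟨v, rfl⟩ : ∃ u', v = u' + 1 := ⟨v - 1, by omega⟩
    have Vi : S.V i := ⟨hi, by omega⟩
    have Vi' : S.V (i + 1) := ⟨by omega, by omega⟩
    obtain ⟨p, c, hp, hpc⟩ := S.word_aff Vi S.V_m (u + 1)
    obtain ⟨q, c', hq, hqc⟩ := S.word_aff Vi' S.V_one (v + 1)
    have E1 : (S.f i ∘ (S.f S.m)^[u + 1]) = fun x => p * x + c := funext hpc
    have E2 : (S.f (i + 1) ∘ (S.f 1)^[v + 1]) = fun x => q * x + c' := funext hqc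
    have e3 := e1.symm.trans e2
    rw [E1, E2, I, aff_image hp, aff_image hq] at e3
    have hne : p * S.a + c ≤ p * S.b + c := by nlinarith
    obtain ⟨k1, k2⟩ := (Icc_eq_Icc_iff hne).1 e3
    have hpq : p = q := by
      have : (p - q) * (S.b - S.a) = 0 := by linarith
      rcases mul_eq_zero.1 this with h | h <;> linarith
    subst hpq
    have hcc : c = c' := by linarith
    subst hcc
    have eqn : ∀ x, S.f i ((S.f S.m)^[u + 1] x) = S.f (i + 1) ((S.f 1)^[v + 1] x) := fun x => by
      rw [hpc, hqc]
    refine ⟨u, v, eqn, ?_⟩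
    intro x hx y hy hxy
    have : S.f i x ∈ S.f i '' S.I ∩ S.f (i + 1) '' S.I := ⟨⟨x, hx, rfl⟩, ⟨y, hy, hxy.symm⟩⟩
    rw [e1] at this
    obtain ⟨z, hz, hzx⟩ := this
    refine ⟨z, hz, (S.f_inj Vi hzx).symm, ?_⟩
    apply S.f_inj Vi'
    rw [← eqn, ← hxy]; exact hzx.symm
  · rw [ov_iff]; simpa using hi2

/-! ### Reflection -/

/-- The reflected system. -/
def rf (S : ClassE) : ClassE where
  m := S.m
  r := fun i => S.r (S.m + 1 - i)
  t := fun i => - S.t (S.m + 1 - i)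
  E := (fun x => -x) '' S.E
  hm := S.hm
  hr := fun i h1 h2 => S.hr _ (by omega) (by omega)
  hEne := S.hEne.image _
  hEcpt := S.hEcpt.image continuous_neg
  hEinv := by
    ext x
    simp only [mem_iUnion, mem_image, Finset.mem_Icc]
    constructor
    · rintro ⟨y, hy, rfl⟩
      obtain ⟨i, hi, hy'⟩ := S.E_cases hy
      have hi1 := hi.1
      have hi2 := hi.2
      refine ⟨S.m + 1 - i, ⟨by omega, by omega⟩, -S.g i y, ⟨_, hy', rfl⟩, ?_⟩
      have : S.m + 1 - (S.m + 1 - i) = i := by omega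
      rw [this]
      have := S.f_g hi y
      unfold f at this; linarith
    · rintro ⟨i, hi, _, ⟨y, hy, rfl⟩, rfl⟩
      refine ⟨S.f (S.m + 1 - i) y, S.f_mem_E ⟨by omega, by omega⟩ hy, ?_⟩
      unfold f; ring

lemma rf_f (S : ClassE) (i : ℕ) (x : ℝ) : S.rf.f i x = - S.f (S.m + 1 - i) (-x) := by
  simp only [rf, f]; ring

lemma rf_it (S : ClassE) (i n : ℕ) (x : ℝ) :
    (S.rf.f i)^[n] x = - (S.f (S.m + 1 - i))^[n] (-x) := by
  induction n with
  | zero => simp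
  | succ n ih => rw [Function.iterate_succ_apply', Function.iterate_succ_apply', ih, rf_f, neg_neg]

lemma rf_m (S : ClassE) : S.rf.m = S.m := rfl
lemma rf_V (S : ClassE) {i : ℕ} : S.rf.V i ↔ S.V i := Iff.rfl

lemma rf_a (S : ClassE) : S.rf.a = - S.b := by
  have : S.rf.E = -S.E := by simp [rf]
  rw [a, b, this, Real.sInf_def, neg_neg]
lemma rf_b (S : ClassE) : S.rf.b = - S.a := by
  have : S.rf.E = -S.E := by simp [rf]
  rw [a, b, this, Real.sInf_def, neg_neg]

lemma rf_I (S : ClassE) {x : ℝ} : x ∈ S.rf.I ↔ -x ∈ S.I := by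
  simp only [I, rf_a, rf_b, mem_Icc]
  constructor <;> rintro ⟨h1, h2⟩ <;> constructor <;> linarith

lemma rf_ov (S : ClassE) {i : ℕ} (_h1 : 1 ≤ i) (hi : i + 1 ≤ S.m) : S.rf.ov i ↔ S.ov (S.m - i) := by
  have e1 : S.m + 1 - i = S.m - i + 1 := by omega
  have e2 : S.m + 1 - (i + 1) = S.m - i := by omega
  constructor
  · rintro ⟨x, hx, y, hy, h⟩
    rw [rf_f, rf_f, e1, e2, neg_inj] at h
    exact ⟨-y, S.rf_I.1 hy, -x, S.rf_I.1 hx, h.symm⟩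
  · rintro ⟨x, hx, y, hy, h⟩
    refine ⟨-y, S.rf_I.2 (by simpa), -x, S.rf_I.2 (by simpa), ?_⟩
    rw [rf_f, rf_f, e1, e2, neg_neg, neg_neg, h]

lemma Good.rf {S : ClassE} (G : S.Good) : S.rf.Good := by
  have hm := S.hm
  refine ⟨?_, ?_, ?_, ?_, ?_, ?_⟩
  · rw [rf_a, rf_b]; linarith [G.ab]
  · rw [rf_f, rf_a, neg_neg]; simp [G.fb]
  · rw [rf_f, rf_b, neg_neg, rf_m]; simp [G.fa]
  · intro i j hi hij hj x hx y hy h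
    rw [rf_m] at hj
    rw [rf_f, rf_f, neg_inj] at h
    exact G.far _ _ (by omega) (by omega) (by omega) _ (S.rf_I.1 hy) _ (S.rf_I.1 hx) h.symm
  · intro i hi him hov
    rw [rf_m] at him
    rw [rf_ov _ hi him] at hov
    obtain ⟨u, v, h1, h2⟩ := G.near (S.m - i) (by omega) (by omega) hov
    have e1 : S.m + 1 - i = S.m - i + 1 := by omega
    have e2 : S.m + 1 - (i + 1) = S.m - i := by omega
    have e3 : S.m + 1 - S.m = 1 := by omega
    have e4 : S.m + 1 - 1 = S.m := by omega
    refine ⟨v, u, fun x => ?_, ?_⟩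
    · rw [rf_it, rf_it, rf_f, rf_f, neg_neg, neg_neg, e1, e2, rf_m, e3, e4, h1]
    · intro x hx y hy h
      rw [rf_f, rf_f, neg_inj, e1, e2] at h
      obtain ⟨z, hz, k1, k2⟩ := h2 _ (S.rf_I.1 hy) _ (S.rf_I.1 hx) h.symm
      refine ⟨-z, S.rf_I.2 (by simpa), ?_, ?_⟩
      · rw [rf_it, neg_neg, rf_m, e3, ← k2, neg_neg]
      · rw [rf_it, neg_neg, e4, ← k1, neg_neg]
  · obtain ⟨i, hi, him, h⟩ := G.gap
    refine ⟨S.m - i, by omega, by rw [rf_m]; omega, ?_⟩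
    rw [rf_ov _ (by omega) (by omega)]
    have : S.m - (S.m - i) = i := by omega
    rwa [this]

/-- reflect digits -/
def fl (m : ℕ) (d : ℕ → ℕ) : ℕ → ℕ := fun n => m + 1 - d n

lemma fl_cons (m i : ℕ) (d : ℕ → ℕ) : fl m (cons i d) = cons (m + 1 - i) (fl m d) := by
  funext n; cases n <;> rfl

lemma fl_fl (S : ClassE) {d : ℕ → ℕ} (hd : ∀ n, S.V (d n)) : fl S.m (fl S.m d) = d := by
  funext n
  have := (hd n).2
  simp only [fl]; omega

lemma rf_prefix (S : ClassE) {d : ℕ → ℕ} (hd : ∀ n, S.V (d n)) (n : ℕ) (x : ℝ) :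
    S.rf.prefixMap (fl S.m d) n x = - S.prefixMap d n (-x) := by
  induction n generalizing x with
  | zero => simp [prefixMap]
  | succ n ih =>
    have := (hd n).2
    have e : S.m + 1 - (S.m + 1 - d n) = d n := by omega
    simp only [prefixMap, Function.comp_apply]
    rw [ih, rf_f, neg_neg, fl, e]

lemma rf_coding (S : ClassE) {d : ℕ → ℕ} {x : ℝ} (h : d ∈ S.codings x) :
    fl S.m d ∈ S.rf.codings (-x) := by
  refine ⟨fun n => ?_, ?_⟩
  · have := h.1 n
    simp only [fl, rf_m]; omega
  · simp only [S.rf_prefix h.1, neg_zero]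
    exact h.2.neg

lemma rf_rf (S : ClassE) {d : ℕ → ℕ} {x : ℝ} (h : d ∈ S.rf.codings x) :
    fl S.m d ∈ S.codings (-x) := by
  have hV : ∀ n, S.V (d n) := h.1
  have hV' : ∀ n, S.V (fl S.m d n) := fun n => by
    have := hV n
    simp only [V, fl] at this ⊢; omega
  refine ⟨hV', ?_⟩
  have h2 := h.2.neg
  have : (fun n => - S.rf.prefixMap d n 0) = fun n => S.prefixMap (fl S.m d) n 0 := by
    funext n
    have := S.rf_prefix hV' n 0
    rw [S.fl_fl hV] at this
    rw [this]; simp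
  rwa [this] at h2

lemma rf_codings (S : ClassE) (x : ℝ) : S.codings x = fl S.m '' S.rf.codings (-x) := by
  ext d
  constructor
  · intro h
    exact ⟨_, S.rf_coding h, S.fl_fl h.1⟩
  · rintro ⟨e, he, rfl⟩
    simpa using S.rf_rf he

lemma rf_mk (S : ClassE) (x : ℝ) : Cardinal.mk (S.codings x) = Cardinal.mk (S.rf.codings (-x)) := by
  rw [rf_codings]
  apply Cardinal.mk_image_eq_of_injOn
  intro d hd e he h
  rw [← S.fl_fl (d := d) hd.1, ← S.fl_fl (d := e) he.1, h]

lemma rf_U (S : ClassE) (k : Cardinal) : S.U k = (fun x => -x) '' S.rf.U k := by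
  ext x
  constructor
  · rintro ⟨h1, h2⟩
    exact ⟨-x, ⟨⟨x, h1, rfl⟩, by rw [← rf_mk]; exact h2⟩, neg_neg x⟩
  · rintro ⟨_, ⟨⟨y, hy, rfl⟩, h2⟩, rfl⟩
    simp only [neg_neg]
    refine ⟨hy, ?_⟩
    rw [rf_mk]; exact h2

lemma rf_dimU (S : ClassE) (k : Cardinal) : dimH (S.U k) = dimH (S.rf.U k) := by
  rw [rf_U]
  exact (IsometryEquiv.neg ℝ).isometry.dimH_image _

/-! ### Branching -/

lemma nosplit (S : ClassE) {i : ℕ} (hi : S.V i) (y : ℝ)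
    (h : ∀ j, S.V j → j ≠ i → ∀ y' ∈ S.I, S.f i y ≠ S.f j y') :
    S.codings (S.f i y) = cons i '' S.codings y := by
  ext d
  constructor
  · intro hd
    obtain ⟨h0, h1⟩ := S.coding_step hd
    by_cases hdi : d 0 = i
    · rw [hdi, S.g_f hi] at h1
      exact ⟨_, h1, by rw [← hdi, cons_tl]⟩
    · exact absurd (S.f_g h0 _).symm (h _ h0 hdi _ (S.mem_I_of_coding h1))
  · rintro ⟨e, he, rfl⟩
    exact (S.coding_cons hi).2 he

namespace Good
variable {S : ClassE} (G : S.Good)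
include G

lemma disj {x y : ℝ} (hx : x ∈ S.I) (hy : y ∈ S.I) : S.f 1 x ≠ S.f S.m y :=
  G.far 1 S.m le_rfl S.hm le_rfl x hx y hy

lemma nos {i : ℕ} (hi : S.V i) {y : ℝ} (hy : y ∈ S.I)
    (h1 : i + 1 ≤ S.m → S.ov i → ∀ w ∈ S.I, y ≠ S.f S.m w)
    (h2 : ∀ j, 1 ≤ j → i = j + 1 → S.ov j → ∀ w ∈ S.I, y ≠ S.f 1 w) :
    S.codings (S.f i y) = cons i '' S.codings y := by
  apply S.nosplit hi
  intro j hj hji y' hy' h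
  have := hi.1; have := hi.2; have := hj.1; have := hj.2
  rcases lt_or_gt_of_ne hji with hlt | hlt
  · by_cases e : i = j + 1
    · subst e
      have hov : S.ov j := ⟨y', hy', y, hy, h.symm⟩
      obtain ⟨u, v, -, k⟩ := G.near j (by omega) (by omega) hov
      obtain ⟨z, hz, -, hz2⟩ := k _ hy' _ hy h.symm
      rw [Function.iterate_succ_apply'] at hz2
      exact h2 j (by omega) rfl hov _ (S.fit_I S.V_one v hz) hz2
    · exact G.far j i (by omega) (by omega) (by omega) _ hy' _ hy h.symm
  · by_cases e : j = i + 1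
    · subst e
      have hov : S.ov i := ⟨y, hy, y', hy', h⟩
      obtain ⟨u, v, -, k⟩ := G.near i (by omega) (by omega) hov
      obtain ⟨z, hz, hz2, -⟩ := k _ hy _ hy' h
      rw [Function.iterate_succ_apply'] at hz2
      exact h1 (by omega) hov _ (S.fit_I S.V_m u hz) hz2
    · exact G.far i j (by omega) (by omega) (by omega) _ hy _ hy' h

lemma nos_m {y : ℝ} (hy : y ∈ S.I) (h : S.ov (S.m - 1) → ∀ w ∈ S.I, y ≠ S.f 1 w) :
    S.codings (S.f S.m y) = cons S.m '' S.codings y := by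
  refine G.nos S.V_m hy (fun h => by omega) (fun j hj e ho => ?_)
  have : j = S.m - 1 := by omega
  subst this
  exact h ho

lemma nos_1 {y : ℝ} (hy : y ∈ S.I) (h : S.ov 1 → ∀ w ∈ S.I, y ≠ S.f S.m w) :
    S.codings (S.f 1 y) = cons 1 '' S.codings y :=
  G.nos S.V_one hy (fun _ => h) (fun j hj e ho => by omega)

lemma split {i u v : ℕ} (h1 : 1 ≤ i) (hi : i + 1 ≤ S.m)
    (eqn : ∀ x, S.f i ((S.f S.m)^[u + 1] x) = S.f (i + 1) ((S.f 1)^[v + 1] x))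
    {y : ℝ} (hy : y ∈ S.I) :
    S.codings (S.f i ((S.f S.m)^[u + 1] y)) =
      cons i '' S.codings ((S.f S.m)^[u + 1] y) ∪
        cons (i + 1) '' S.codings ((S.f 1)^[v + 1] y) := by
  have Vi : S.V i := ⟨h1, by omega⟩
  have Vi' : S.V (i + 1) := ⟨by omega, by omega⟩
  ext d
  constructor
  · intro hd
    obtain ⟨h0, h1⟩ := S.coding_step hd
    have hI := S.mem_I_of_coding h1
    by_cases hdi : d 0 = i
    · left
      rw [hdi, S.g_f Vi] at h1
      exact ⟨_, h1, by rw [← hdi, cons_tl]⟩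
    by_cases hdi' : d 0 = i + 1
    · right
      rw [hdi', eqn, S.g_f Vi'] at h1
      exact ⟨_, h1, by rw [← hdi', cons_tl]⟩
    exfalso
    have e := S.f_g h0 (S.f i ((S.f S.m)^[u + 1] y))
    have := h0.1; have := h0.2
    rcases lt_or_ge (d 0) i with hl | hl
    · rw [eqn] at e hI
      exact G.far _ _ (by omega) (by omega) (by omega) _ hI _ (S.fit_I S.V_one _ hy) e
    · exact G.far _ _ (by omega) (by omega) (by omega) _ (S.fit_I S.V_m _ hy) _ hI e.symm
  · rintro (⟨e, he, rfl⟩ | ⟨e, he, rfl⟩)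
    · exact (S.coding_cons Vi).2 he
    · rw [eqn]; exact (S.coding_cons Vi').2 he

lemma branch {x : ℝ} {d e : ℕ → ℕ} (hd : d ∈ S.codings x) (he : e ∈ S.codings x)
    (hne : d 0 ≠ e 0) : ∃ i u v, 1 ≤ i ∧ i + 1 ≤ S.m ∧ S.ov i ∧
      (∀ x, S.f i ((S.f S.m)^[u + 1] x) = S.f (i + 1) ((S.f 1)^[v + 1] x)) ∧
      ∃ z ∈ S.I, x = S.f i ((S.f S.m)^[u + 1] z) := by
  wlog hlt : d 0 < e 0 generalizing d e
  · exact this he hd hne.symm (by omega)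
  obtain ⟨h0, h1⟩ := S.coding_step hd
  obtain ⟨k0, k1⟩ := S.coding_step he
  have hI := S.mem_I_of_coding h1
  have kI := S.mem_I_of_coding k1
  have := h0.1; have := k0.2
  have eq : S.f (d 0) (S.g (d 0) x) = S.f (e 0) (S.g (e 0) x) := by rw [S.f_g h0, S.f_g k0]
  have e1 : e 0 = d 0 + 1 := by
    by_contra hc
    exact G.far _ _ (by omega) (by omega) (by omega) _ hI _ kI eq
  rw [e1] at eq kI
  have hov : S.ov (d 0) := ⟨_, hI, _, kI, eq⟩
  obtain ⟨u, v, eqn, k⟩ := G.near (d 0) (by omega) (by omega) hov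
  obtain ⟨z, hz, hz1, hz2⟩ := k _ hI _ kI eq
  exact ⟨d 0, u, v, by omega, by omega, hov, eqn, z, hz, by rw [← hz1, S.f_g h0]⟩

lemma mm {y : ℝ} (hy : y ∈ S.I) (n : ℕ) :
    S.codings ((S.f S.m)^[n + 1] y) = (cons S.m)^[n] '' S.codings (S.f S.m y) := by
  induction n with
  | zero => simp
  | succ n ih =>
    rw [Function.iterate_succ_apply', G.nos_m (S.fit_I S.V_m _ hy), ih, ← image_comp,
      Function.iterate_succ']
    intro _ w hw h
    rw [Function.iterate_succ_apply'] at h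
    exact G.disj hw (S.fit_I S.V_m _ hy) h.symm

lemma m1 {y : ℝ} (hy : y ∈ S.I) (n : ℕ) :
    S.codings ((S.f 1)^[n + 1] y) = (cons 1)^[n] '' S.codings (S.f 1 y) := by
  induction n with
  | zero => simp
  | succ n ih =>
    rw [Function.iterate_succ_apply', G.nos_1 (S.fit_I S.V_one _ hy), ih, ← image_comp,
      Function.iterate_succ']
    intro _ w hw h
    rw [Function.iterate_succ_apply'] at h
    exact G.disj (S.fit_I S.V_one _ hy) hw h

omit G in
lemma sub_it {i : ℕ} (hi : S.V i) (n : ℕ) (y : ℝ) :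
    (cons i)^[n] '' S.codings y ⊆ S.codings ((S.f i)^[n] y) := by
  induction n with
  | zero => simp
  | succ n ih =>
    rw [Function.iterate_succ_apply', Function.iterate_succ', image_comp]
    rintro _ ⟨e, he, rfl⟩
    exact (S.coding_cons hi).2 (ih he)

lemma it1_sub_a (n : ℕ) (z : ℝ) : (S.f 1)^[n] z - S.a = S.r 1 ^ n * (z - S.a) := by
  induction n with
  | zero => simp
  | succ n ih =>
    have h := G.fa
    rw [Function.iterate_succ_apply']
    have : S.f 1 ((S.f 1)^[n] z) - S.f 1 S.a = S.r 1 * ((S.f 1)^[n] z - S.a) := by unfold f; ring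
    rw [h] at this
    rw [this, ih]; ring

end Good

/-- ideals of sets of streams -/
structure Ideal' (P : Set (ℕ → ℕ) → Prop) : Prop where
  sub : ∀ s t, s ⊆ t → P t → P s
  un : ∀ s t, P s → P t → P (s ∪ t)
  co : ∀ i s, P s ↔ P (cons i '' s)

lemma Ideal'.it {P : Set (ℕ → ℕ) → Prop} (hP : Ideal' P) (i n : ℕ) (s : Set (ℕ → ℕ)) :
    P s ↔ P ((cons i)^[n] '' s) := by
  induction n with
  | zero => simp
  | succ n ih => rw [Function.iterate_succ', image_comp, ← hP.co, ih]

lemma ideal_fin : Ideal' Set.Finite :=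
  ⟨fun _ _ h h' => h'.subset h, fun _ _ h h' => h.union h',
    fun i _ => (Set.finite_image_iff (cons_inj i).injOn).symm⟩

lemma ideal_empty : Ideal' (fun s => s = ∅) :=
  ⟨fun _ _ h h' => by subst h'; exact subset_empty_iff.1 h, fun _ _ h h' => by simp [h, h'],
    fun i s => by simp⟩

lemma fl_image_cons (m i : ℕ) (s : Set (ℕ → ℕ)) :
    fl m '' (cons i '' s) = cons (m + 1 - i) '' (fl m '' s) := by
  rw [← image_comp, ← image_comp]
  congr 1
  funext d
  exact fl_cons m i d

lemma Ideal'.fl {P : Set (ℕ → ℕ) → Prop} (hP : Ideal' P) (m : ℕ) :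
    Ideal' (fun s => P (fl m '' s)) :=
  ⟨fun _ _ h h' => hP.sub _ _ (image_mono h) h',
    fun _ _ h h' => by rw [image_union]; exact hP.un _ _ h h',
    fun i s => by rw [fl_image_cons, ← hP.co]⟩

namespace Good
variable {S : ClassE} (G : S.Good)
include G

lemma lemL_aux {P : Set (ℕ → ℕ) → Prop} (hP : Ideal' P) (n : ℕ) {z : ℝ} (hz : z ∈ S.I)
    (hn : S.r 1 ^ n * (S.b - S.a) < z - S.a) (h : P (S.codings z)) :
    P (S.codings (S.f S.m z)) := by
  induction n generalizing z with
  | zero => exfalso; have := hz.2; simp at hn; linarith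
  | succ n ih =>
    have hm := S.hm
    by_cases hov : S.ov (S.m - 1)
    swap
    · rw [G.nos_m hz (fun h => absurd h hov)]
      exact (hP.co _ _).1 h
    obtain ⟨u, v, eqn, k⟩ := G.near (S.m - 1) (by omega) (by omega) hov
    have e : S.m - 1 + 1 = S.m := by omega
    rw [e] at eqn k
    by_cases hx : ∃ x ∈ S.I, S.f (S.m - 1) x = S.f S.m z
    · obtain ⟨x, hx, hxz⟩ := hx
      obtain ⟨w, hw, rfl, rfl⟩ := k x hx z hz hxz
      have h2 := G.split (i := S.m - 1) (u := u) (v := v) (by omega) (by omega) (fun x => by rw [eqn, e]) hw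
      rw [eqn, e] at h2
      rw [h2]
      have hPw : P (S.codings w) := by
        rw [hP.it 1 (v + 1)]
        exact hP.sub _ _ (sub_it S.V_one _ _) h
      have r0 := S.r_pos S.V_one
      have r1 := S.r_lt S.V_one
      have hww : S.r 1 ^ n * (S.b - S.a) < w - S.a := by
        rw [G.it1_sub_a] at hn
        have hwa : 0 ≤ w - S.a := by linarith [hw.1]
        have : S.r 1 ^ (v + 1) * (w - S.a) ≤ S.r 1 * (w - S.a) := by
          gcongr
          exact pow_le_of_le_one r0.le r1.le (by omega)
        have h3 : S.r 1 * (S.r 1 ^ n * (S.b - S.a)) < S.r 1 * (w - S.a) := by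
          calc _ = S.r 1 ^ (n + 1) * (S.b - S.a) := by ring
            _ < _ := hn.trans_le this
        exact lt_of_mul_lt_mul_left h3 r0.le
      refine hP.un _ _ ?_ ?_
      · rw [← hP.co, G.mm hw, ← hP.it]
        exact ih hw hww hPw
      · rw [← hP.co]; exact h
    · rw [S.nosplit S.V_m z]
      · exact (hP.co _ _).1 h
      · intro j hj hjm y hy heq
        have := hj.1; have := hj.2
        by_cases hjm' : j = S.m - 1
        · subst hjm'
          exact hx ⟨y, hy, heq.symm⟩
        · exact G.far j S.m (by omega) (by omega) le_rfl y hy z hz heq.symm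

lemma lemL {P : Set (ℕ → ℕ) → Prop} (hP : Ideal' P) {z : ℝ} (hz : z ∈ S.I)
    (ha : S.ov (S.m - 1) → z ≠ S.a) (h : P (S.codings z)) :
    P (S.codings (S.f S.m z)) := by
  by_cases hov : S.ov (S.m - 1)
  swap
  · rw [G.nos_m hz (fun h => absurd h hov)]
    exact (hP.co _ _).1 h
  have hpos : 0 < z - S.a := by
    have := lt_of_le_of_ne hz.1 (ha hov).symm
    linarith
  have hab : 0 < S.b - S.a := by linarith [G.ab]
  obtain ⟨n, hn⟩ := exists_pow_lt_of_lt_one (div_pos hpos hab) (S.r_lt S.V_one)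
  rw [lt_div_iff₀ hab] at hn
  exact G.lemL_aux hP n hz hn h

lemma lemR {P : Set (ℕ → ℕ) → Prop} (hP : Ideal' P) {z : ℝ} (hz : z ∈ S.I)
    (hb : S.ov 1 → z ≠ S.b) (h : P (S.codings z)) :
    P (S.codings (S.f 1 z)) := by
  have hm := S.hm
  have := G.rf.lemL (hP.fl S.m) (z := -z) (S.rf_I.2 (by simpa)) ?_ ?_
  · rw [rf_f, neg_neg, rf_m] at this
    have e : S.m + 1 - S.m = 1 := by omega
    rw [e] at this
    rw [rf_codings]
    exact this
  · rw [rf_m, rf_ov _ (by omega) (by omega), rf_a]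
    have e : S.m - (S.m - 1) = 1 := by omega
    rw [e]
    intro h1 h2
    exact hb h1 (neg_injective h2)
  · rw [← rf_codings]; exact h

lemma lemLit {P : Set (ℕ → ℕ) → Prop} (hP : Ideal' P) {z : ℝ} (hz : z ∈ S.I)
    (ha : S.ov (S.m - 1) → z ≠ S.a) (h : P (S.codings z)) (n : ℕ) :
    P (S.codings ((S.f S.m)^[n + 1] z)) := by
  rw [G.mm hz, ← hP.it]; exact G.lemL hP hz ha h

lemma lemRit {P : Set (ℕ → ℕ) → Prop} (hP : Ideal' P) {z : ℝ} (hz : z ∈ S.I)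
    (hb : S.ov 1 → z ≠ S.b) (h : P (S.codings z)) (n : ℕ) :
    P (S.codings ((S.f 1)^[n + 1] z)) := by
  rw [G.m1 hz, ← hP.it]; exact G.lemR hP hz hb h

end Good

/-! ### The exceptional set -/

/-- exceptional points -/
def X (S : ClassE) : Set ℝ :=
  {x | ∃ w : List ℕ, (∀ i ∈ w, S.V i) ∧
    ((S.ov 1 ∧ x = S.F w (S.f 1 S.b)) ∨ (S.ov (S.m - 1) ∧ x = S.F w (S.f S.m S.a)))}

lemma X_countable (S : ClassE) : S.X.Countable := by
  have : S.X ⊆ (range fun w => S.F w (S.f 1 S.b)) ∪ (range fun w => S.F w (S.f S.m S.a)) := by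
    rintro x ⟨w, -, ⟨-, rfl⟩ | ⟨-, rfl⟩⟩
    · exact Or.inl ⟨w, rfl⟩
    · exact Or.inr ⟨w, rfl⟩
  exact ((countable_range _).union (countable_range _)).mono this

lemma X_f (S : ClassE) {i : ℕ} (hi : S.V i) {x : ℝ} (hx : x ∈ S.X) : S.f i x ∈ S.X := by
  obtain ⟨w, hw, h⟩ := hx
  refine ⟨i :: w, ?_, ?_⟩
  · intro j hj
    rcases List.mem_cons.1 hj with rfl | hj
    · exact hi
    · exact hw j hj
  · rcases h with ⟨h, rfl⟩ | ⟨h, rfl⟩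
    · exact Or.inl ⟨h, rfl⟩
    · exact Or.inr ⟨h, rfl⟩

lemma X_it (S : ClassE) {i : ℕ} (hi : S.V i) (n : ℕ) {x : ℝ} (hx : x ∈ S.X) :
    (S.f i)^[n] x ∈ S.X := by
  induction n with
  | zero => exact hx
  | succ n ih => rw [Function.iterate_succ_apply']; exact S.X_f hi ih

/-- non-exceptional point with infinitely many codings -/
def Q (S : ClassE) (z : ℝ) : Prop := z ∉ S.X ∧ (S.codings z).Infinite

lemma Q_I (S : ClassE) {z : ℝ} (h : S.Q z) : z ∈ S.I := by
  obtain ⟨d, hd⟩ := h.2.nonempty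
  exact S.mem_I_of_coding hd

namespace Good
variable {S : ClassE} (G : S.Good)
include G

lemma branchQ {i u v : ℕ} (h1 : 1 ≤ i) (hi : i + 1 ≤ S.m)
    (eqn : ∀ x, S.f i ((S.f S.m)^[u + 1] x) = S.f (i + 1) ((S.f 1)^[v + 1] x))
    {z : ℝ} (hz : z ∈ S.I) (hQ : S.Q (S.f i ((S.f S.m)^[u + 1] z))) :
    S.Q ((S.f S.m)^[u + 1] z) ∧ S.Q ((S.f 1)^[v + 1] z) := by
  have Vi : S.V i := ⟨h1, by omega⟩
  have Vi' : S.V (i + 1) := ⟨by omega, by omega⟩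
  obtain ⟨hX, hinf⟩ := hQ
  have hX1 : (S.f S.m)^[u + 1] z ∉ S.X := fun h => hX (S.X_f Vi h)
  have hX2 : (S.f 1)^[v + 1] z ∉ S.X := fun h => hX (by rw [eqn]; exact S.X_f Vi' h)
  have ha : S.ov (S.m - 1) → z ≠ S.a := by
    rintro ho rfl
    apply hX1
    rw [Function.iterate_succ_apply]
    exact S.X_it S.V_m u ⟨[], by simp, Or.inr ⟨ho, rfl⟩⟩
  have hb : S.ov 1 → z ≠ S.b := by
    rintro ho rfl
    apply hX2
    rw [Function.iterate_succ_apply]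
    exact S.X_it S.V_one v ⟨[], by simp, Or.inl ⟨ho, rfl⟩⟩
  have hzi : (S.codings z).Infinite := by
    intro hf
    apply hinf
    rw [G.split h1 hi eqn hz]
    exact ideal_fin.un _ _ ((ideal_fin.co _ _).1 (G.lemLit ideal_fin hz ha hf u))
      ((ideal_fin.co _ _).1 (G.lemRit ideal_fin hz hb hf v))
  refine ⟨⟨hX1, fun hf => hzi ?_⟩, ⟨hX2, fun hf => hzi ?_⟩⟩
  · exact (ideal_fin.it S.m (u + 1) _).2 (hf.subset (sub_it S.V_m _ _))
  · exact (ideal_fin.it 1 (v + 1) _).2 (hf.subset (sub_it S.V_one _ _))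

/-- Either all codings start with the same digit, or we branch -/
lemma cases {x : ℝ} (hx : (S.codings x).Nonempty) :
    (∃ i, S.V i ∧ S.codings x = cons i '' S.codings (S.g i x)) ∨
    ∃ i u v, 1 ≤ i ∧ i + 1 ≤ S.m ∧ S.ov i ∧
      (∀ x, S.f i ((S.f S.m)^[u + 1] x) = S.f (i + 1) ((S.f 1)^[v + 1] x)) ∧
      ∃ z ∈ S.I, x = S.f i ((S.f S.m)^[u + 1] z) := by
  obtain ⟨d, hd⟩ := hx
  by_cases h : ∀ e ∈ S.codings x, e 0 = d 0
  · left
    have hV := (S.coding_step hd).1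
    refine ⟨d 0, hV, ?_⟩
    ext e
    constructor
    · intro he
      have := (S.coding_step he).2
      rw [h e he] at this
      exact ⟨_, this, by rw [← h e he, cons_tl]⟩
    · rintro ⟨e, he, rfl⟩
      have := (S.coding_cons hV).2 he
      rwa [S.f_g hV] at this
  · right
    push Not at h
    obtain ⟨e, he, hne⟩ := h
    exact G.branch he hd hne

omit G in
lemma Q_child {i : ℕ} {x : ℝ} (hi : S.V i) (h : S.codings x = cons i '' S.codings (S.g i x))
    (hQ : S.Q x) : S.Q (S.g i x) := by
  refine ⟨fun hX => hQ.1 ?_, ?_⟩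
  · have := S.X_f hi hX
    rwa [S.f_g hi] at this
  · intro hf
    apply hQ.2
    rw [h]
    exact hf.image _

lemma Q_step {x : ℝ} (hQ : S.Q x) : ∃ i, S.V i ∧ S.Q (S.g i x) := by
  rcases G.cases hQ.2.nonempty with ⟨i, hi, h⟩ | ⟨i, u, v, h1, hi, -, eqn, z, hz, rfl⟩
  · exact ⟨i, hi, Q_child hi h hQ⟩
  · have Vi : S.V i := ⟨h1, by omega⟩
    refine ⟨i, Vi, ?_⟩
    rw [S.g_f Vi]
    exact (G.branchQ h1 hi eqn hz hQ).1

lemma Q_two {x : ℝ} (hQ : S.Q x) : ∃ d ∈ S.Ray S.Q x, ∃ e ∈ S.Ray S.Q x, d ≠ e := by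
  obtain ⟨d, hd, e, he, hne⟩ := hQ.2.nontrivial
  obtain ⟨k, hk⟩ := Function.ne_iff.1 hne
  clear hne
  induction k using Nat.strong_induction_on generalizing x d e with
  | _ k ih =>
  rcases G.cases hQ.2.nonempty with ⟨i, hi, h⟩ | ⟨i, u, v, h1, hi, -, eqn, z, hz, rfl⟩
  · rw [h] at hd he
    obtain ⟨d, hd, rfl⟩ := hd
    obtain ⟨e, he, rfl⟩ := he
    cases k with
    | zero => exact absurd rfl hk
    | succ k =>
      obtain ⟨d', hd', e', he', hne⟩ :=
        ih k (by omega) (Q_child hi h hQ) d hd e he (by simpa using hk)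
      exact ⟨_, S.ray_cons hi hQ hd', _, S.ray_cons hi hQ he', fun h => hne (cons_inj i h)⟩
  · have Vi : S.V i := ⟨h1, by omega⟩
    have Vi' : S.V (i + 1) := ⟨by omega, by omega⟩
    obtain ⟨q1, q2⟩ := G.branchQ h1 hi eqn hz hQ
    obtain ⟨d', hd'⟩ := S.ray_exists (fun _ h => G.Q_step h) q1
    obtain ⟨e', he'⟩ := S.ray_exists (fun _ h => G.Q_step h) q2
    refine ⟨cons i d', S.ray_cons Vi hQ (by rwa [S.g_f Vi]),
      cons (i + 1) e', S.ray_cons Vi' hQ (by rwa [eqn, S.g_f Vi']), fun h => ?_⟩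
    have := congrFun h 0
    simp at this

lemma Q_two_at {x : ℝ} {d : ℕ → ℕ} (hd : d ∈ S.Ray S.Q x) (n : ℕ) :
    ∃ e ∈ S.Ray S.Q x, e ≠ d ∧ ∀ k < n, e k = d k := by
  induction n generalizing x d with
  | zero =>
    obtain ⟨e, he, e', he', hne⟩ := G.Q_two (hd.2 0)
    by_cases h : e = d
    · exact ⟨e', he', fun h' => hne (h.trans h'.symm), by simp⟩
    · exact ⟨e, he, h, by simp⟩
  | succ n ih =>
    have : tl d ∈ S.Ray S.Q (S.g (d 0) x) := by
      refine ⟨fun n => hd.1 (n + 1), fun n => ?_⟩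
      rw [← S.pt_cons, cons_tl]
      exact hd.2 _
    obtain ⟨e, he, hne, h⟩ := ih this
    refine ⟨cons (d 0) e, S.ray_cons (hd.1 0) (hd.2 0) he, ?_, ?_⟩
    · rintro h
      apply hne
      rw [← h]; simp
    · intro k hk
      cases k with
      | zero => rfl
      | succ k => exact h k (by omega)

lemma Q_unc {x : ℝ} (hQ : S.Q x) : ¬ (S.codings x).Countable := by
  let _ : MetricSpace (ℕ → ℕ) := PiNat.metricSpaceNatNat
  have hcs : CompleteSpace (ℕ → ℕ) := inferInstance
  intro hc
  have hc' : (S.Ray S.Q x).Countable := hc.mono (S.ray_sub fun _ => S.Q_I)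
  have hcl : IsClosed (S.Ray S.Q x) := by
    refine isClosed_of_closure_subset fun d hd => ?_
    have key : ∀ n, ∃ e ∈ S.Ray S.Q x, ∀ k < n, e k = d k := by
      intro n
      obtain ⟨e, he1, he2⟩ := mem_closure_iff.1 hd (PiNat.cylinder d n)
        (PiNat.isOpen_cylinder _ d n) (PiNat.self_mem_cylinder d n)
      exact ⟨e, he2, fun k hk => he1 k hk⟩
    refine ⟨fun n => ?_, fun n => ?_⟩
    · obtain ⟨e, he, h⟩ := key (n + 1)
      rw [← h n (by omega)]; exact he.1 n
    · obtain ⟨e, he, h⟩ := key n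
      rw [← S.pt_congr x h]; exact he.2 n
  have hpre : Preperfect (S.Ray S.Q x) := by
    intro d hd
    rw [accPt_iff_nhds]
    intro U hU
    obtain ⟨_, ⟨y, n, rfl⟩, hdy, hsub⟩ :=
      (PiNat.isTopologicalBasis_cylinders (fun _ : ℕ => ℕ)).mem_nhds_iff.1 hU
    obtain ⟨e, he, hne, h⟩ := G.Q_two_at hd n
    refine ⟨e, ⟨hsub ?_, he⟩, hne⟩
    intro k hk
    rw [h k hk]; exact hdy k hk
  obtain ⟨φ, hφ, -, hinj⟩ := Perfect.exists_nat_bool_injection ⟨hcl, hpre⟩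
    (S.ray_exists (fun _ h => G.Q_step h) hQ)
  have h1 : (range φ).Countable := hc'.mono hφ
  have h2 : (univ : Set (ℕ → Bool)).Countable := by
    rw [← image_univ] at h1
    exact countable_of_injective_of_countable_image hinj.injOn h1
  have h3 : Countable (ℕ → Bool) := countable_univ_iff.1 h2
  have h4 := Cardinal.mk_le_aleph0_iff.2 h3
  simp only [Cardinal.mk_pi, Cardinal.mk_bool, Cardinal.prod_const, Cardinal.lift_id,
    Cardinal.mk_nat] at h4
  exact absurd h4 (not_le.2 (by simpa using Cardinal.cantor Cardinal.aleph0))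

lemma U_sub : S.U Cardinal.aleph0 ⊆ S.X := by
  rintro x ⟨-, hx⟩
  by_contra hX
  have hinf : (S.codings x).Infinite := by
    rw [← Set.infinite_coe_iff, Cardinal.infinite_iff, hx]
  exact G.Q_unc ⟨hX, hinf⟩ (Cardinal.mk_le_aleph0_iff.1 hx.le)

end Good
/-! ### The case where the first two pieces overlap -/

lemma f_lip (S : ClassE) (i : ℕ) : ∃ K, LipschitzWith K (S.f i) := by
  refine ⟨Real.nnabs (S.r i), LipschitzWith.of_dist_le_mul fun x y => ?_⟩
  rw [Real.dist_eq, Real.dist_eq, Real.coe_nnabs, ← abs_mul]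
  apply le_of_eq; congr 1; unfold f; ring

lemma g_lip (S : ClassE) (i : ℕ) : ∃ K, LipschitzWith K (S.g i) := by
  refine ⟨Real.nnabs (S.r i)⁻¹, LipschitzWith.of_dist_le_mul fun x y => ?_⟩
  rw [Real.dist_eq, Real.dist_eq, Real.coe_nnabs, ← abs_mul]
  apply le_of_eq; congr 1; unfold g; rw [div_eq_mul_inv, div_eq_mul_inv]; ring

lemma F_lip (S : ClassE) (w : List ℕ) : ∃ K, LipschitzWith K (S.F w) := by
  induction w with
  | nil => exact ⟨1, LipschitzWith.id⟩
  | cons i w ih =>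
    obtain ⟨K, hK⟩ := ih
    obtain ⟨L, hL⟩ := S.f_lip i
    exact ⟨_, hL.comp hK⟩

lemma dim_F (S : ClassE) (w : List ℕ) (s : Set ℝ) : dimH (S.F w '' s) ≤ dimH s :=
  (S.F_lip w).choose_spec.dimH_image_le s
lemma dim_f (S : ClassE) (i : ℕ) (s : Set ℝ) : dimH (S.f i '' s) ≤ dimH s :=
  (S.f_lip i).choose_spec.dimH_image_le s
lemma dim_g (S : ClassE) (i : ℕ) (s : Set ℝ) : dimH (S.g i '' s) ≤ dimH s :=
  (S.g_lip i).choose_spec.dimH_image_le s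
lemma dim_f_ge (S : ClassE) {i : ℕ} (hi : S.V i) (s : Set ℝ) : dimH s ≤ dimH (S.f i '' s) := by
  have := S.dim_g i (S.f i '' s)
  rw [← image_comp] at this
  have e : S.g i ∘ S.f i = id := funext (S.g_f hi)
  rwa [e, image_id] at this
lemma dim_fit_ge (S : ClassE) {i : ℕ} (hi : S.V i) (n : ℕ) (s : Set ℝ) :
    dimH s ≤ dimH ((S.f i)^[n] '' s) := by
  induction n with
  | zero => simp
  | succ n ih =>
    rw [Function.iterate_succ', image_comp]
    exact ih.trans (S.dim_f_ge hi _)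

lemma U_one_iff (S : ClassE) {x : ℝ} : x ∈ S.U 1 ↔ ∃ d, S.codings x = {d} := by
  constructor
  · rintro ⟨-, h⟩; exact Cardinal.mk_set_eq_one_iff.1 h
  · rintro ⟨d, h⟩
    refine ⟨S.mem_E_of_coding (d := d) (by simp [h]), Cardinal.mk_set_eq_one_iff.2 ⟨d, h⟩⟩

lemma U_fin_sub (S : ClassE) {x : ℝ} (hf : (S.codings x).Finite) (hne : (S.codings x).Nonempty) :
    ∃ w : List ℕ, ∃ y ∈ S.U 1, S.F w y = x := by
  obtain ⟨d, hd⟩ := hne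
  have h1 : ∀ e : ℕ → ℕ, e ≠ d → ∃ n, e n ≠ d n := fun e he => Function.ne_iff.1 he
  choose! c hc using h1
  obtain ⟨N, hN⟩ := (hf.image c).bddAbove
  obtain ⟨w, hl, hw, y, hy, hcy, hdw⟩ := S.coding_split hd (N + 1)
  refine ⟨w, y, S.U_one_iff.2 ⟨fun k => d (N + 1 + k), ?_⟩, hy.symm⟩
  apply Set.eq_singleton_iff_unique_mem.2 ⟨hcy, fun e he => ?_⟩
  apply foldr_inj w
  change w.foldr cons e = w.foldr cons _
  rw [← hdw]
  by_contra hne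
  have hmem : w.foldr cons e ∈ S.codings x := by rw [hy]; exact S.F_coding w hw he
  have h2 := hN ⟨_, hmem, rfl⟩
  apply hc _ hne
  conv_rhs => rw [hdw]
  exact foldr_apply_lt _ _ _ (by omega)

lemma dimU_le (S : ClassE) {k : ℕ} (hk : 1 ≤ k) : dimH (S.U k) ≤ dimH (S.U 1) := by
  have hsub : S.U k ⊆ ⋃ w : List ℕ, S.F w '' S.U 1 := by
    rintro x ⟨-, hx⟩
    have hf : (S.codings x).Finite := by
      rw [← Set.finite_coe_iff, ← Cardinal.lt_aleph0_iff_finite, hx]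
      exact Cardinal.natCast_lt_aleph0
    have hne : (S.codings x).Nonempty := by
      rw [← Set.nonempty_coe_sort, ← Cardinal.mk_ne_zero_iff, hx]
      exact_mod_cast (by omega : k ≠ 0)
    obtain ⟨w, y, hy, rfl⟩ := S.U_fin_sub hf hne
    exact mem_iUnion.2 ⟨w, y, hy, rfl⟩
  refine (dimH_mono hsub).trans ?_
  rw [dimH_iUnion]
  exact iSup_le fun w => S.dim_F w _

/-- univoque points away from the extreme pieces -/
def VV (S : ClassE) : Set ℝ :=
  {z | z ∈ S.U 1 ∧ (∀ w ∈ S.I, z ≠ S.f 1 w) ∧ ∀ w ∈ S.I, z ≠ S.f S.m w}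

lemma it_cons_agree {i k : ℕ} (n : ℕ) {d e : ℕ → ℕ} (h : ∀ j < k, d j = e j) :
    ∀ j < k + n, (cons i)^[n] d j = (cons i)^[n] e j := by
  induction n with
  | zero => exact h
  | succ n ih =>
    intro j hj
    rw [Function.iterate_succ_apply', Function.iterate_succ_apply']
    cases j with
    | zero => rfl
    | succ j => exact ih j (by omega)

namespace Good
variable {S : ClassE} (G : S.Good)
include G

lemma code_b : S.codings S.b = {fun _ => S.m} := by
  have h : S.codings S.b = cons S.m '' S.codings S.b := by
    have := G.nos_m (y := S.b) S.b_I ?_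
    · rwa [G.fb] at this
    · intro _ w hw h
      rw [← G.fb] at h
      exact G.disj hw S.b_I h.symm
  have key : ∀ n, ∀ d ∈ S.codings S.b, d n = S.m := by
    intro n
    induction n with
    | zero => intro d hd; rw [h] at hd; obtain ⟨e, -, rfl⟩ := hd; rfl
    | succ n ih => intro d hd; rw [h] at hd; obtain ⟨e, he, rfl⟩ := hd; exact ih e he
  obtain ⟨d, hd⟩ := S.coding_exists S.b_mem
  have hd' : ∀ e ∈ S.codings S.b, e = fun _ => S.m := fun e he => funext fun n => key n e he
  exact Set.eq_singleton_iff_unique_mem.2 ⟨hd' d hd ▸ hd, hd'⟩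

lemma code_f1b (ho : S.ov 1) : Cardinal.mk (S.codings (S.f 1 S.b)) = Cardinal.aleph0 := by
  have hm := S.hm
  obtain ⟨u, v, eqn, -⟩ := G.near 1 le_rfl (by omega) ho
  have h1 := G.split le_rfl (by omega) eqn S.b_I
  rw [Function.iterate_fixed G.fb, G.m1 S.b_I, G.code_b, image_singleton, singleton_union] at h1
  set D := S.codings (S.f 1 S.b)
  set e := cons 1 (fun _ => S.m)
  set T : (ℕ → ℕ) → ℕ → ℕ := fun d => cons 2 ((cons 1)^[v] d) with hT
  have hTinj : Function.Injective T := fun d d' h => (cons_inj 1).iterate v (cons_inj 2 h)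
  have hD : D = insert e (T '' D) := by
    conv_lhs => rw [h1]
    rw [← image_comp]; rfl
  have heT : ∀ d, T d ≠ e := fun d h => by
    have := congrFun h 0
    simp [hT, e] at this
  have hinf : D.Infinite := by
    intro hf
    have h2 := congrArg Set.ncard hD
    rw [Set.ncard_insert_of_notMem (by rintro ⟨d, -, h⟩; exact heT d h) (hf.image T),
      Set.ncard_image_of_injective _ hTinj] at h2
    omega
  have hsub : (D \ range (fun k => T^[k] e)).Subsingleton := by
    have step : ∀ d ∈ D \ range (fun k => T^[k] e),
        ∃ d' ∈ D \ range (fun k => T^[k] e), d = T d' := by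
      rintro d ⟨hd, hr⟩
      rw [hD] at hd
      rcases hd with rfl | ⟨d', hd', rfl⟩
      · exact absurd ⟨0, rfl⟩ hr
      · refine ⟨d', ⟨hd', ?_⟩, rfl⟩
        rintro ⟨k, rfl⟩
        exact hr ⟨k + 1, by simp only [Function.iterate_succ_apply']⟩
    have agree : ∀ n, ∀ d ∈ D \ range (fun k => T^[k] e), ∀ d' ∈ D \ range (fun k => T^[k] e),
        ∀ j < n, d j = d' j := by
      intro n
      induction n with
      | zero => simp
      | succ n ih =>
        intro d hd d' hd' j hj
        obtain ⟨c, hc, rfl⟩ := step d hd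
        obtain ⟨c', hc', rfl⟩ := step d' hd'
        cases j with
        | zero => rfl
        | succ j => exact it_cons_agree v (ih c hc c' hc') j (by omega)
    exact fun d hd d' hd' => funext fun n => agree (n + 1) d hd d' hd' n (by omega)
  have hcount : D.Countable := by
    have : D ⊆ (D \ range (fun k => T^[k] e)) ∪ range (fun k => T^[k] e) := by
      intro x hx
      by_cases h : x ∈ range (fun k => T^[k] e)
      · exact Or.inr h
      · exact Or.inl ⟨hx, h⟩
    exact (hsub.countable.union (countable_range _)).mono this
  exact le_antisymm (Cardinal.mk_le_aleph0_iff.2 hcount)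
    (Cardinal.infinite_iff.1 (Set.infinite_coe_iff.2 hinf))

lemma f1b_it (ho : S.ov 1) (n : ℕ) : (S.f 1)^[n + 1] S.b ∈ S.U Cardinal.aleph0 := by
  refine ⟨?_, ?_⟩
  · clear ho
    induction n with
    | zero => exact S.f_mem_E S.V_one S.b_mem
    | succ n ih => rw [Function.iterate_succ_apply']; exact S.f_mem_E S.V_one ih
  · rw [G.m1 S.b_I, Cardinal.mk_image_eq ((cons_inj 1).iterate n), G.code_f1b ho]

lemma Uinf (ho : S.ov 1) : (S.U Cardinal.aleph0).Infinite := by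
  refine Set.infinite_of_injective_forall_mem (f := fun n : ℕ => (S.f 1)^[n + 1] S.b) ?_
    (G.f1b_it ho)
  intro n k h
  have h' : (S.f 1)^[n + 1] S.b - S.a = (S.f 1)^[k + 1] S.b - S.a := by
    simp only at h; rw [h]
  rw [G.it1_sub_a, G.it1_sub_a] at h'
  have hab : S.b - S.a ≠ 0 := by linarith [G.ab]
  have := mul_right_cancel₀ hab h'
  have := (pow_right_injective₀ (S.r_pos S.V_one) (S.r_lt S.V_one).ne) this
  omega

lemma mem_fm {x : ℝ} (hx : (S.codings x).Nonempty) {y : ℝ} (hy : y ∈ S.I) (h : x = S.f S.m y) :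
    (S.codings y).Nonempty := by
  by_contra hc
  rw [not_nonempty_iff_eq_empty] at hc
  have := G.lemL ideal_empty hy (fun _ ha => ?_) hc
  · rw [← h] at this; simp [this] at hx
  · subst ha
    exact (S.coding_exists S.a_mem).ne_empty hc

lemma mem_f1 {x : ℝ} (hx : (S.codings x).Nonempty) {y : ℝ} (hy : y ∈ S.I) (h : x = S.f 1 y) :
    (S.codings y).Nonempty := by
  by_contra hc
  rw [not_nonempty_iff_eq_empty] at hc
  have := G.lemR ideal_empty hy (fun _ ha => ?_) hc
  · rw [← h] at this; simp [this] at hx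
  · subst ha
    exact (S.coding_exists S.b_mem).ne_empty hc

end Good
namespace Good
variable {S : ClassE} (G : S.Good)
include G

lemma fm_it_card {z : ℝ} (hz : z ∈ S.VV) (n : ℕ) :
    Cardinal.mk (S.codings ((S.f S.m)^[n] z)) = 1 := by
  have hzI : z ∈ S.I := S.E_sub hz.1.1
  cases n with
  | zero => exact hz.1.2
  | succ n =>
    rw [G.mm hzI, Cardinal.mk_image_eq ((cons_inj _).iterate n),
      G.nos_m hzI (fun _ => hz.2.1), Cardinal.mk_image_eq (cons_inj _)]
    exact hz.1.2

lemma VV_count {u v : ℕ}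
    (eqn : ∀ x, S.f 1 ((S.f S.m)^[u + 1] x) = S.f (1 + 1) ((S.f 1)^[v + 1] x))
    {z : ℝ} (hz : z ∈ S.VV) (k : ℕ) :
    Cardinal.mk (S.codings (S.f 1 ((S.f S.m)^[(u + 1) * k] z))) = (k + 1 : ℕ) := by
  have hm := S.hm
  have hzI : z ∈ S.I := S.E_sub hz.1.1
  induction k with
  | zero =>
    simp only [mul_zero, Function.iterate_zero, id, zero_add, Nat.cast_one]
    rw [G.nos_1 hzI (fun _ => hz.2.2), Cardinal.mk_image_eq (cons_inj _)]
    exact hz.1.2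
  | succ k ih =>
    have e : (S.f S.m)^[(u + 1) * (k + 1)] z = (S.f S.m)^[u + 1] ((S.f S.m)^[(u + 1) * k] z) := by
      rw [← Function.iterate_add_apply]; congr 1; ring
    have h1 := G.fm_it_card hz ((u + 1) * (k + 1))
    rw [e] at h1 ⊢
    have hI := S.fit_I S.V_m ((u + 1) * k) hzI
    rw [G.split le_rfl (by omega) eqn hI, Cardinal.mk_union_of_disjoint,
      Cardinal.mk_image_eq (cons_inj _), Cardinal.mk_image_eq (cons_inj _), h1, G.m1 hI,
      Cardinal.mk_image_eq ((cons_inj _).iterate v), ih]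
    · push_cast; ring
    · rw [Set.disjoint_left]
      rintro _ ⟨d, -, rfl⟩ ⟨d', -, h⟩
      have := congrFun h 0
      simp at this

lemma not_f1 {x : ℝ} {d : ℕ → ℕ} (h : S.codings x = {d}) (h0 : d 0 ≠ 1) :
    ∀ w ∈ S.I, x ≠ S.f 1 w := by
  intro w hw hx
  obtain ⟨e, he⟩ := G.mem_f1 (by simp [h]) hw hx
  have : cons 1 e ∈ S.codings x := by rw [hx]; exact (S.coding_cons S.V_one).2 he
  rw [h, mem_singleton_iff] at this
  rw [← this] at h0; exact h0 rfl

lemma not_fm {x : ℝ} {d : ℕ → ℕ} (h : S.codings x = {d}) (h0 : d 0 ≠ S.m) :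
    ∀ w ∈ S.I, x ≠ S.f S.m w := by
  intro w hw hx
  obtain ⟨e, he⟩ := G.mem_fm (by simp [h]) hw hx
  have : cons S.m e ∈ S.codings x := by rw [hx]; exact (S.coding_cons S.V_m).2 he
  rw [h, mem_singleton_iff] at this
  rw [← this] at h0; exact h0 rfl

lemma code_a : (fun _ => 1) ∈ S.codings S.a := by
  refine S.coding_of_seq _ (fun _ => S.V_one) S.a |S.a| (fun _ => S.a) (fun _ => le_rfl) ?_
  intro n
  induction n with
  | zero => rfl
  | succ n ih =>
    change S.prefixMap (fun _ => 1) n (S.f 1 S.a) = S.a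
    rw [G.fa]; exact ih

lemma U1_sub (ho : S.ov 1) : ∃ j, S.U 1 ⊆
    ({S.a} ∪ ⋃ w : List ℕ, S.F w '' S.VV) ∪ ⋃ w : List ℕ, S.F w '' (S.g j '' S.VV) := by
  obtain ⟨j, hj1, hjm, hj⟩ := G.gap
  have hj2 : j ≠ 1 := by rintro rfl; exact hj ho
  have Vj : S.V j := ⟨hj1, by omega⟩
  refine ⟨j, fun x hx => ?_⟩
  obtain ⟨d, hd⟩ := S.U_one_iff.1 hx
  have hdx : d ∈ S.codings x := by simp [hd]
  by_cases hall : ∀ n, d n = 1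
  · left; left
    have : d = fun _ => 1 := funext hall
    rw [this] at hdx
    exact S.coding_unique hdx G.code_a
  push Not at hall
  obtain ⟨n, hn⟩ := hall
  obtain ⟨w, hl, hw, y, hy, hcy, hdw⟩ := S.coding_split hdx n
  have hyd : S.codings y = {fun k => d (n + k)} := by
    apply Set.eq_singleton_iff_unique_mem.2 ⟨hcy, fun e he => ?_⟩
    apply foldr_inj w
    change w.foldr cons e = w.foldr cons _
    rw [← hdw]
    have hmem : w.foldr cons e ∈ S.codings x := by rw [hy]; exact S.F_coding w hw he
    rwa [hd] at hmem
  have hyU : y ∈ S.U 1 := S.U_one_iff.2 ⟨_, hyd⟩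
  have hyI : y ∈ S.I := S.E_sub hyU.1
  have hy1 := G.not_f1 hyd (by simpa using hn)
  by_cases hdm : d n = S.m
  · right
    refine mem_iUnion.2 ⟨w, y, ⟨S.f j y, ?_, S.g_f Vj y⟩, hy.symm⟩
    have hc : S.codings (S.f j y) = {cons j fun k => d (n + k)} := by
      rw [G.nos Vj hyI (fun _ h => absurd h hj) (fun _ _ _ _ => hy1), hyd, image_singleton]
    exact ⟨S.U_one_iff.2 ⟨_, hc⟩, G.not_f1 hc hj2, G.not_fm hc (by simp; omega)⟩
  · left; right
    exact mem_iUnion.2 ⟨w, y, ⟨hyU, hy1, G.not_fm hyd (by simpa using hdm)⟩, hy.symm⟩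

lemma dimU1_le (ho : S.ov 1) : dimH (S.U 1) ≤ dimH S.VV := by
  obtain ⟨j, hj⟩ := G.U1_sub ho
  refine (dimH_mono hj).trans ?_
  rw [dimH_union, dimH_union, dimH_iUnion, dimH_iUnion, dimH_singleton]
  refine max_le (max_le zero_le (iSup_le fun w => S.dim_F w _)) (iSup_le fun w => ?_)
  exact (S.dim_F w _).trans (S.dim_g j _)

lemma dimU_eq (ho : S.ov 1) {k : ℕ} (hk : 1 ≤ k) : dimH (S.U k) = dimH (S.U 1) := by
  have hm := S.hm
  refine le_antisymm (S.dimU_le hk) ?_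
  obtain ⟨u, v, eqn, -⟩ := G.near 1 le_rfl (by omega) ho
  obtain ⟨k, rfl⟩ : ∃ l, k = l + 1 := ⟨k - 1, by omega⟩
  refine (G.dimU1_le ho).trans ?_
  refine (S.dim_fit_ge S.V_m ((u + 1) * k) _).trans ?_
  refine (S.dim_f_ge S.V_one _).trans (dimH_mono ?_)
  rintro _ ⟨_, ⟨z, hz, rfl⟩, rfl⟩
  have hc := G.VV_count eqn hz k
  have hne : (S.codings (S.f 1 ((S.f S.m)^[(u + 1) * k] z))).Nonempty := by
    rw [← Set.nonempty_coe_sort, ← Cardinal.mk_ne_zero_iff, hc]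
    exact_mod_cast (by omega : k + 1 ≠ 0)
  exact ⟨S.mem_E_of_coding hne.choose_spec, hc⟩

omit G in
lemma rf_ov1 : S.rf.ov 1 ↔ S.ov (S.m - 1) := S.rf_ov le_rfl (by have := S.hm; omega)

lemma main2 (h : S.ov 1 ∨ S.ov (S.m - 1)) {k : ℕ} (hk : 1 ≤ k) :
    dimH (S.U k) = dimH (S.U 1) := by
  rcases h with h | h
  · exact G.dimU_eq h hk
  · rw [S.rf_dimU, S.rf_dimU]
    exact G.rf.dimU_eq (rf_ov1.2 h) hk

lemma main3 (h : S.ov 1 ∨ S.ov (S.m - 1)) :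
    S.f 1 S.b ∈ S.U Cardinal.aleph0 ∨ S.f S.m S.a ∈ S.U Cardinal.aleph0 := by
  rcases h with h | h
  · exact Or.inl (G.f1b_it h 0)
  · right
    have := G.rf.f1b_it (rf_ov1.2 h) 0
    rw [S.rf_U]
    refine ⟨_, this, ?_⟩
    simp only [zero_add, Function.iterate_one]
    rw [rf_f, rf_b, neg_neg, neg_neg]; rfl

lemma main4 (h : S.ov 1 ∨ S.ov (S.m - 1)) :
    (S.U Cardinal.aleph0).Countable ∧ (S.U Cardinal.aleph0).Infinite := by
  refine ⟨S.X_countable.mono G.U_sub, ?_⟩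
  rcases h with h | h
  · exact G.Uinf h
  · rw [S.rf_U]
    exact (G.rf.Uinf (rf_ov1.2 h)).image neg_injective.injOn

lemma Uempty (h1 : ¬ S.ov 1) (h2 : ¬ S.ov (S.m - 1)) : S.U Cardinal.aleph0 = ∅ := by
  refine subset_empty_iff.1 fun x hx => ?_
  obtain ⟨w, -, h | h⟩ := G.U_sub hx
  · exact h1 h.1
  · exact h2 h.1

lemma br3 (h1 : ¬ S.ov 1) (h2 : ¬ S.ov (S.m - 1)) {i u v : ℕ} (hi1 : 1 ≤ i) (hi : i + 1 ≤ S.m)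
    (eqn : ∀ x, S.f i ((S.f S.m)^[u + 1] x) = S.f (i + 1) ((S.f 1)^[v + 1] x))
    {z : ℝ} (hz : z ∈ S.I) (h3 : (S.codings (S.f i ((S.f S.m)^[u + 1] z))).ncard = 3) : False := by
  have hfin := Set.finite_of_ncard_ne_zero (by omega : (S.codings (S.f i ((S.f S.m)^[u + 1] z))).ncard ≠ 0)
  rw [G.split hi1 hi eqn hz, G.mm hz, G.m1 hz, G.nos_m hz (fun h => absurd h h2),
    G.nos_1 hz (fun h => absurd h h1)] at h3 hfin
  rw [Set.ncard_union_eq ?_ (hfin.subset subset_union_left) (hfin.subset subset_union_right),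
    Set.ncard_image_of_injective _ (cons_inj _),
    Set.ncard_image_of_injective _ (cons_inj _),
    Set.ncard_image_of_injective _ ((cons_inj _).iterate _),
    Set.ncard_image_of_injective _ ((cons_inj _).iterate _),
    Set.ncard_image_of_injective _ (cons_inj _),
    Set.ncard_image_of_injective _ (cons_inj _)] at h3
  · omega
  · rw [Set.disjoint_left]
    rintro _ ⟨d, -, rfl⟩ ⟨d', -, h⟩
    have := congrFun h 0
    simp at this

lemma no3 (h1 : ¬ S.ov 1) (h2 : ¬ S.ov (S.m - 1)) {x : ℝ} : (S.codings x).ncard ≠ 3 := by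
  intro h3
  have hfin : (S.codings x).Finite := Set.finite_of_ncard_ne_zero (by omega)
  have : Finite (S.codings x) := hfin
  obtain ⟨d, hd, e, he, hne⟩ := Set.one_lt_ncard_iff_nontrivial.1 (by omega : 1 < (S.codings x).ncard)
  obtain ⟨k, hk⟩ := Function.ne_iff.1 hne
  clear hne hfin this
  induction k generalizing x d e with
  | zero =>
    obtain ⟨i, u, v, hi1, hi, -, eqn, z, hz, rfl⟩ := G.branch hd he hk
    exact G.br3 h1 h2 hi1 hi eqn hz h3
  | succ k ih =>
    rcases G.cases ⟨d, hd⟩ with ⟨i, hi, h⟩ | ⟨i, u, v, hi1, hi, -, eqn, z, hz, rfl⟩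
    · rw [h] at hd he h3
      obtain ⟨d, hd, rfl⟩ := hd
      obtain ⟨e, he, rfl⟩ := he
      rw [Set.ncard_image_of_injective _ (cons_inj _)] at h3
      exact ih h3 _ hd _ he hk
    · exact G.br3 h1 h2 hi1 hi eqn hz h3

lemma dimU3 (h1 : ¬ S.ov 1) (h2 : ¬ S.ov (S.m - 1)) : dimH (S.U (3 : ℕ)) = 0 := by
  have : S.U (3 : ℕ) = ∅ := by
    refine subset_empty_iff.1 fun x hx => ?_
    apply G.no3 h1 h2 (x := x)
    have := hx.2
    rw [← Nat.card_coe_set_eq, Nat.card, this]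
    exact Cardinal.toNat_natCast 3
  rw [this, dimH_empty]

end Good
lemma coding_pt (S : ClassE) (d : ℕ → ℕ) (hd : ∀ n, S.V (d n)) : ∃ x, d ∈ S.codings x := by
  obtain ⟨ρ, h0, h1, hρ⟩ := S.exists_rho
  have hc : CauchySeq (fun n => S.prefixMap d n 0) := by
    refine cauchySeq_of_le_geometric ρ (∑ i ∈ Finset.Icc 1 S.m, |S.t i|) h1 fun n => ?_
    rw [Real.dist_eq]
    refine (S.prefix_dist h0 hρ d hd n 0 (S.f (d n) 0)).trans ?_
    rw [mul_comm]
    gcongr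
    have : |0 - S.f (d n) 0| = |S.t (d n)| := by simp [f]
    rw [this]
    exact Finset.single_le_sum (f := fun i => |S.t i|) (fun i _ => abs_nonneg _)
      (Finset.mem_Icc.2 (hd n))
  obtain ⟨x, hx⟩ := cauchySeq_tendsto_of_complete hc
  exact ⟨x, hd, hx⟩

namespace Good
variable {S : ClassE} (G : S.Good)
include G

lemma ext_unique (h1 : ¬ S.ov 1) (h2 : ¬ S.ov (S.m - 1)) {x : ℝ} {d : ℕ → ℕ}
    (hd : d ∈ S.codings x) (hdd : ∀ n, d n = 1 ∨ d n = S.m) : x ∈ S.U 1 := by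
  have key : ∀ n, ∀ x d, d ∈ S.codings x → (∀ n, d n = 1 ∨ d n = S.m) →
      ∀ e ∈ S.codings x, e n = d n := by
    intro n
    induction n with
    | zero =>
      intro x d hd hdd e he
      obtain ⟨hV, ht⟩ := S.coding_step hd
      have hI := S.mem_I_of_coding ht
      have hx := S.f_g hV x
      have : S.codings (S.f (d 0) (S.g (d 0) x)) = cons (d 0) '' S.codings (S.g (d 0) x) := by
        rcases hdd 0 with h | h
        · rw [h] at hI ⊢; exact G.nos_1 hI (fun h => absurd h h1)
        · rw [h] at hI ⊢; exact G.nos_m hI (fun h => absurd h h2)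
      rw [hx] at this
      rw [this] at he
      obtain ⟨e, -, rfl⟩ := he
      rfl
    | succ n ih =>
      intro x d hd hdd e he
      obtain ⟨hV, ht⟩ := S.coding_step hd
      have hI := S.mem_I_of_coding ht
      have hx := S.f_g hV x
      have : S.codings (S.f (d 0) (S.g (d 0) x)) = cons (d 0) '' S.codings (S.g (d 0) x) := by
        rcases hdd 0 with h | h
        · rw [h] at hI ⊢; exact G.nos_1 hI (fun h => absurd h h1)
        · rw [h] at hI ⊢; exact G.nos_m hI (fun h => absurd h h2)
      rw [hx] at this
      rw [this] at he
      obtain ⟨e, he, rfl⟩ := he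
      exact ih _ _ ht (fun n => hdd (n + 1)) e he
  exact S.U_one_iff.2 ⟨d, Set.eq_singleton_iff_unique_mem.2
    ⟨hd, fun e he => funext fun n => key n x d hd hdd e he⟩⟩

lemma delta_pos : 0 < S.f S.m S.a - S.f 1 S.b := by
  by_contra h
  have h' : S.f S.m S.a ≤ S.f 1 S.b := by linarith
  have : S.f S.m S.a ∈ S.f 1 '' S.I := by
    rw [S.f_image S.V_one, G.fa]
    exact ⟨(S.f_I S.V_m S.a_I).1, h'⟩
  obtain ⟨w, hw, e⟩ := this
  exact G.disj hw S.a_I e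

omit G in
lemma sep {ρ : ℝ} (hρ0 : 0 ≤ ρ) (hρ1 : ρ ≤ S.r 1) (hρm : ρ ≤ S.r S.m) (n : ℕ) {x y : ℝ} {d e : ℕ → ℕ}
    (hd : d ∈ S.codings x) (hdd : ∀ n, d n = 1 ∨ d n = S.m)
    (he : e ∈ S.codings y) (hee : ∀ n, e n = 1 ∨ e n = S.m)
    (hag : ∀ k < n, d k = e k) (hne : d n ≠ e n) :
    (S.f S.m S.a - S.f 1 S.b) * ρ ^ n ≤ |x - y| := by
  induction n generalizing x y d e with
  | zero =>
    wlog h0 : d 0 = 1 generalizing x y d e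
    · rw [abs_sub_comm]
      refine this he hee hd hdd (by simp) hne.symm ?_
      have := hdd 0; have := hee 0
      omega
    have h0' : e 0 = S.m := by
      rcases hee 0 with h | h
      · omega
      · exact h
    obtain ⟨hV, ht⟩ := S.coding_step hd
    obtain ⟨hV', ht'⟩ := S.coding_step he
    have hI := S.mem_I_of_coding ht
    have hI' := S.mem_I_of_coding ht'
    rw [h0] at hI
    rw [h0'] at hI'
    have e1 := (S.f_mono S.V_one).monotone hI.2
    have e2 := (S.f_mono S.V_m).monotone hI'.1
    rw [S.f_g S.V_one] at e1
    rw [S.f_g S.V_m] at e2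
    rw [abs_sub_comm]
    have := le_abs_self (y - x)
    simp only [pow_zero, mul_one]
    linarith
  | succ n ih =>
    obtain ⟨hV, ht⟩ := S.coding_step hd
    obtain ⟨hV', ht'⟩ := S.coding_step he
    have h := ih ht (fun n => hdd (n + 1)) ht' (fun n => hee (n + 1))
      (fun k hk => hag (k + 1) (by omega)) hne
    rw [← hag 0 (by omega)] at h
    have hx := S.f_g hV x
    have hy := S.f_g hV y
    set x' := S.g (d 0) x
    set y' := S.g (d 0) y
    have e1 : x - y = S.r (d 0) * (x' - y') := by rw [← hx, ← hy]; unfold f; ring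
    have hr : ρ ≤ S.r (d 0) := by rcases hdd 0 with h | h <;> rw [h] <;> assumption
    rw [e1, abs_mul, abs_of_pos (S.r_pos hV)]
    calc _ = ρ * ((S.f S.m S.a - S.f 1 S.b) * ρ ^ n) := by ring
      _ ≤ ρ * |x' - y'| := by gcongr
      _ ≤ _ := by gcongr

lemma dimU1_pos (h1 : ¬ S.ov 1) (h2 : ¬ S.ov (S.m - 1)) : dimH (S.U 1) ≠ 0 := by
  have hm := S.hm
  have hδ := G.delta_pos
  set ρ := min (S.r 1) (S.r S.m) with hρd
  have hρ : 0 < ρ := lt_min (S.r_pos S.V_one) (S.r_pos S.V_m)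
  have hρ1 : ρ < 1 := (min_le_left _ _).trans_lt (S.r_lt S.V_one)
  let D : (ℕ → Fin 2) → ℕ → ℕ := fun s n => if s n = 0 then 1 else S.m
  have hDD : ∀ s n, D s n = 1 ∨ D s n = S.m := by
    intro s n
    by_cases h : s n = 0 <;> simp [D, h]
  have hDV : ∀ s n, S.V (D s n) := by
    intro s n
    rcases hDD s n with h | h <;> rw [h]
    exacts [S.V_one, S.V_m]
  have hDne : ∀ s s' n, s n ≠ s' n → D s n ≠ D s' n := by
    intro s s' n h
    by_cases h0 : s n = 0 <;> by_cases h0' : s' n = 0 <;> simp [D, h0, h0'] <;> omega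
  choose p hp using fun s => S.coding_pt (D s) (hDV s)
  set δ := S.f S.m S.a - S.f 1 S.b
  have hsep : ∀ s s', s ≠ s' → ∃ n, (∀ k < n, s k = s' k) ∧ δ * ρ ^ n ≤ |p s - p s'| := by
    intro s s' h
    classical
    have hex := Function.ne_iff.1 h
    refine ⟨Nat.find hex, ?_, ?_⟩
    · intro k hk
      have := Nat.find_min hex hk
      push Not at this
      exact this
    · refine sep hρ.le (min_le_left _ _) (min_le_right _ _) _ (hp s) (hDD s) (hp s') (hDD s') ?_
        (hDne _ _ _ (Nat.find_spec hex))
      intro k hk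
      have := Nat.find_min hex hk
      push Not at this
      simp only [D, this]
  have hinj : Function.Injective p := by
    intro s s' h
    by_contra hne
    obtain ⟨n, -, hn⟩ := hsep s s' hne
    rw [h, sub_self, abs_zero] at hn
    have : 0 < δ * ρ ^ n := by positivity
    linarith
  have hU : range p ⊆ S.U 1 := by
    rintro _ ⟨s, rfl⟩
    exact G.ext_unique h1 h2 (hp s) (hDD s)
  let h : ℝ → ℝ := fun x => Real.ofDigits (Function.invFun p x)
  set α : ℝ := Real.log 2 / (- Real.log ρ) with hα
  have hlog : 0 < - Real.log ρ := by linarith [Real.log_neg hρ hρ1]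
  have hα0 : 0 < α := div_pos (Real.log_pos one_lt_two) hlog
  have hρα : ρ ^ α = 1 / 2 := by
    rw [Real.rpow_def_of_pos hρ, hα]
    have : Real.log ρ * (Real.log 2 / -Real.log ρ) = - Real.log 2 := by
      have : Real.log ρ ≠ 0 := by linarith
      field_simp
    rw [this, Real.exp_neg, Real.exp_log two_pos]; norm_num
  have hH : HolderOnWith (Real.toNNReal (δ ^ (-α))) (Real.toNNReal α) h (range p) := by
    rintro _ ⟨s, rfl⟩ _ ⟨s', rfl⟩
    by_cases hss : s = s'
    · subst hss; simp
    obtain ⟨n, hag, hn⟩ := hsep s s' hss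
    have e1 : ∀ s, h (p s) = Real.ofDigits s := fun s => by
      simp only [h, Function.leftInverse_invFun hinj s]
    rw [e1, e1, edist_dist, edist_dist, Real.coe_toNNReal _ hα0.le,
      ENNReal.ofReal_rpow_of_nonneg dist_nonneg hα0.le]
    change _ ≤ ENNReal.ofReal _ * _
    rw [← ENNReal.ofReal_mul (by positivity)]
    apply ENNReal.ofReal_le_ofReal
    rw [Real.dist_eq, Real.dist_eq]
    have e2 : |Real.ofDigits s - Real.ofDigits s'| ≤ ((2 : ℝ) ^ n)⁻¹ := by
      have := Real.abs_ofDigits_sub_ofDigits_le (b := 2) (x := s) (y := s') (n := n) (by simpa using hag)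
      simpa using this
    refine e2.trans ?_
    have e3 : (δ * ρ ^ n) ^ α ≤ |p s - p s'| ^ α := by
      apply Real.rpow_le_rpow (by positivity) hn hα0.le
    have e4 : (δ * ρ ^ n) ^ α = δ ^ α * ((2 : ℝ) ^ n)⁻¹ := by
      rw [Real.mul_rpow hδ.le (by positivity), ← Real.rpow_natCast ρ n, ← Real.rpow_mul hρ.le,
        mul_comm (n : ℝ), Real.rpow_mul hρ.le, hρα, Real.rpow_natCast]
      simp
    rw [e4] at e3
    calc ((2 : ℝ) ^ n)⁻¹ = δ ^ (-α) * (δ ^ α * ((2 : ℝ) ^ n)⁻¹) := by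
          rw [← mul_assoc, ← Real.rpow_add hδ]; simp
      _ ≤ _ := by gcongr
  have hα0' : 0 < Real.toNNReal α := Real.toNNReal_pos.2 hα0
  have hdim := hH.dimH_image_le hα0'
  have himg : Icc (0 : ℝ) 1 ⊆ h '' range p := by
    intro t ht
    obtain ⟨s, -, hs⟩ := Real.ofDigits_SurjOn (b := 2) (by norm_num) ht
    refine ⟨p s, ⟨s, rfl⟩, ?_⟩
    simp only [h, Function.leftInverse_invFun hinj s, hs]
  have hone : dimH (h '' range p) = 1 := by
    rw [Real.dimH_of_nonempty_interior]
    · simp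
    refine Set.Nonempty.mono (interior_mono himg) ?_
    rw [interior_Icc]
    exact ⟨1/2, by norm_num, by norm_num⟩
  intro h0
  have h00 : dimH (range p) = 0 := le_antisymm (h0 ▸ dimH_mono hU) zero_le
  rw [hone, h00] at hdim
  simp at hdim

end Good
end ClassE

open ClassE

theorem stmt0 (S : ClassE) (hS : S.goodE) :
    List.TFAE
      [ (S.f 1 '' S.I ∩ S.f 2 '' S.I ≠ ∅ ∨ S.f (S.m - 1) '' S.I ∩ S.f S.m '' S.I ≠ ∅),
        (∀ k : ℕ, 1 ≤ k → dimH (S.U k) = dimH (S.U 1)),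
        (S.f 1 S.b ∈ S.U Cardinal.aleph0 ∨ S.f S.m S.a ∈ S.U Cardinal.aleph0),
        ((S.U Cardinal.aleph0).Countable ∧ (S.U Cardinal.aleph0).Infinite) ] := by
  have G := S.good_of_goodE hS
  have hm := S.hm
  have e1 : S.f 1 '' S.I ∩ S.f 2 '' S.I ≠ ∅ ↔ S.ov 1 := (S.ov_iff 1).symm
  have e2 : S.f (S.m - 1) '' S.I ∩ S.f S.m '' S.I ≠ ∅ ↔ S.ov (S.m - 1) := by
    rw [S.ov_iff, Nat.sub_add_cancel (by omega : 1 ≤ S.m)]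
  rw [e1, e2]
  tfae_have 1 → 2 := fun h k hk => G.main2 h hk
  tfae_have 1 → 3 := G.main3
  tfae_have 1 → 4 := G.main4
  tfae_have 2 → 1 := by
    intro h
    by_contra hc
    push Not at hc
    apply G.dimU1_pos hc.1 hc.2
    rw [← h 3 (by norm_num)]
    exact G.dimU3 hc.1 hc.2
  tfae_have 3 → 1 := by
    intro h
    by_contra hc
    push Not at hc
    rw [G.Uempty hc.1 hc.2] at h
    simp at h
  tfae_have 4 → 1 := by
    intro h
    by_contra hc
    push Not at hc
    rw [G.Uempty hc.1 hc.2] at h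
    simp at h
  tfae_finish
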